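/- arXiv:1308.6596 — 2 statements merged into one kernel-verified Lean document; each statement's English description precedes it below -/
import Mathlib

section
/- The unital K-algebra homomorphism φ : A_d → W_d determined by φ(x_j) = (y_j, a_j) for j = 1,…,d has kernel exactly (A_d')². In particular φ induces an injective K-algebra homomorphism (an embedding) ι : F_d = A_d/(A_d')² → W_d. -/
noncomputable section

/-- The metabelian relation on the free associative algebra:
products of two commutators are identified with zero. -/
def MetabRel (K : Type*) [CommRing K] (d : ℕ) (p q : FreeAlgebra K (Fin d)) : Prop :=
  q = 0 ∧ ∃ a b c e : FreeAlgebra K (Fin d), p = (a * b - b * a) * (c * e - e * c)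

/-- The free metabelian associative algebra `F_d = A_d/(A_d')²`. -/
abbrev FreeMetab (K : Type*) [CommRing K] (d : ℕ) := RingQuot (MetabRel K d)

/-- The commutator ideal `A_d'` of the free algebra `A_d`:
the two-sided ideal generated by all commutators. -/
def Aprime (K : Type*) [CommRing K] (d : ℕ) : Ideal (FreeAlgebra K (Fin d)) :=
  Ideal.span {z | ∃ a f g b : FreeAlgebra K (Fin d), z = a * (f * g - g * f) * b}


abbrev PolyY (K : Type*) [CommRing K] (d : ℕ) := MvPolynomial (Fin d) K
/-- `K[U_d, V_d']`, with `inl = u`-variables and `inr = v'`-variables. -/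
abbrev Poly2 (K : Type*) [CommRing K] (d : ℕ) := MvPolynomial (Fin d ⊕ Fin d) K
/-- The free `K[U_d,V_d']`-module `M_d` with basis `a_1,…,a_d`. -/
abbrev Md (K : Type*) [CommRing K] (d : ℕ) := Fin d → Poly2 K d

/-- `K[Y_d] → K[U_d,V_d']`, `y_j ↦ u_j`. -/
def toU (K : Type*) [CommRing K] (d : ℕ) : PolyY K d →+* Poly2 K d :=
  (MvPolynomial.aeval fun j : Fin d => (MvPolynomial.X (Sum.inl j) : Poly2 K d)).toRingHom

/-- `K[Y_d] → K[U_d,V_d']`, `y_j ↦ v_j'`. -/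
def toV (K : Type*) [CommRing K] (d : ℕ) : PolyY K d →+* Poly2 K d :=
  (MvPolynomial.aeval fun j : Fin d => (MvPolynomial.X (Sum.inr j) : Poly2 K d)).toRingHom

/-- left action of `K[Y_d]` on `M_d`: `y_j · a_i = a_i u_j`. -/
instance instLmod (K : Type*) [CommRing K] (d : ℕ) : Module (PolyY K d) (Md K d) :=
  Module.compHom _ (toU K d)

def toVop (K : Type*) [CommRing K] (d : ℕ) : (PolyY K d)ᵐᵒᵖ →+* Poly2 K d where
  toFun r := toV K d r.unop
  map_one' := by simp
  map_mul' a b := by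
    simp [MulOpposite.unop_mul, map_mul, mul_comm]
  map_zero' := by simp
  map_add' a b := by simp

/-- right action of `K[Y_d]` on `M_d`: `a_i · y_j = a_i v_j'`. -/
instance instRmod (K : Type*) [CommRing K] (d : ℕ) : Module (PolyY K d)ᵐᵒᵖ (Md K d) :=
  Module.compHom _ (toVop K d)

instance instComm (K : Type*) [CommRing K] (d : ℕ) :
    SMulCommClass (PolyY K d) (PolyY K d)ᵐᵒᵖ (Md K d) where
  smul_comm r s m := by
    funext i
    show toU K d r * (toVop K d s * m i) = toVop K d s * (toU K d r * m i)
    ring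

instance instT1 (K : Type*) [CommRing K] (d : ℕ) : IsScalarTower K (PolyY K d) (Md K d) where
  smul_assoc k p m := by
    funext i
    show toU K d (k • p) * m i = k • (toU K d p * m i)
    rw [Algebra.smul_def, Algebra.smul_def, map_mul]
    simp [toU, mul_assoc]

instance instT2 (K : Type*) [CommRing K] (d : ℕ) : IsScalarTower K (PolyY K d)ᵐᵒᵖ (Md K d) where
  smul_assoc k p m := by
    funext i
    show toVop K d (k • p) * m i = k • (toVop K d p * m i)
    have h : toVop K d (k • p) = k • toVop K d p := by
      simp only [toVop, RingHom.coe_mk, MonoidHom.coe_mk, OneHom.coe_mk,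
        MulOpposite.unop_smul]
      exact map_smul (MvPolynomial.aeval fun j : Fin d => (MvPolynomial.X (Sum.inr j) : Poly2 K d)).toLinearMap k p.unop
    rw [h, smul_mul_assoc]

/-- The wreath product `W_d = K[Y_d] ⋉ M_d`. -/
abbrev Wd (K : Type*) [CommRing K] (d : ℕ) := TrivSqZeroExt (PolyY K d) (Md K d)

/-- The algebra homomorphism `φ : A_d → W_d`, `x_j ↦ (y_j, a_j)`. -/
def phiW (K : Type*) [CommRing K] (d : ℕ) : FreeAlgebra K (Fin d) →ₐ[K] Wd K d :=
  FreeAlgebra.lift K fun j : Fin d =>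
    (TrivSqZeroExt.inl (MvPolynomial.X j) + TrivSqZeroExt.inr (Pi.single j 1) : Wd K d)

namespace MetabEmb

variable {K : Type*} [Field K] {d : ℕ}

/-- abelianization -/
def ab (K : Type*) [Field K] (d : ℕ) : FreeAlgebra K (Fin d) →ₐ[K] PolyY K d :=
  FreeAlgebra.lift K fun j => (MvPolynomial.X j : PolyY K d)

theorem fst_phi (f : FreeAlgebra K (Fin d)) : (phiW K d f).fst = ab K d f := by
  induction f using FreeAlgebra.induction with
  | grade0 r => simp only [AlgHom.commutes]; rfl
  | grade1 x => simp [phiW, ab]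
  | mul a b ha hb => rw [map_mul, map_mul, TrivSqZeroExt.fst_mul, ha, hb]
  | add a b ha hb => rw [map_add, map_add, TrivSqZeroExt.fst_add, ha, hb]

theorem Aprime_le_ker {f : FreeAlgebra K (Fin d)} (hf : f ∈ Aprime K d) : ab K d f = 0 := by
  unfold Aprime at hf
  induction hf using Submodule.span_induction with
  | mem x h =>
    obtain ⟨a, f, g, b, rfl⟩ := h
    simp only [map_mul, map_sub]; ring
  | zero => simp
  | add x y _ _ hx hy => simp [hx, hy]
  | smul r x _ hx => simp [hx]

theorem Aprime_mul_right {f : FreeAlgebra K (Fin d)} (hf : f ∈ Aprime K d)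
    (r : FreeAlgebra K (Fin d)) : f * r ∈ Aprime K d := by
  unfold Aprime at hf
  induction hf using Submodule.span_induction with
  | mem x h =>
    obtain ⟨a, f, g, b, rfl⟩ := h
    exact Ideal.subset_span ⟨a, f, g, b * r, by simp only [mul_assoc]⟩
  | zero => simp
  | add x y _ _ hx hy => rw [add_mul]; exact add_mem hx hy
  | smul s x _ hx => rw [smul_eq_mul, mul_assoc]; exact Ideal.mul_mem_left _ _ hx

instance : (Aprime K d).IsTwoSided := ⟨fun b h => Aprime_mul_right h b⟩

instance quotComm : CommRing (FreeAlgebra K (Fin d) ⧸ Aprime K d) :=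
  { (inferInstance : Ring (FreeAlgebra K (Fin d) ⧸ Aprime K d)) with
    mul_comm := by
      intro a b
      obtain ⟨a, rfl⟩ := Ideal.Quotient.mk_surjective a
      obtain ⟨b, rfl⟩ := Ideal.Quotient.mk_surjective b
      rw [← map_mul, ← map_mul, Ideal.Quotient.eq]
      exact Ideal.subset_span ⟨1, a, b, 1, by simp⟩ }

theorem ker_le_Aprime {f : FreeAlgebra K (Fin d)} (hf : ab K d f = 0) : f ∈ Aprime K d := by
  let t : PolyY K d →+* (FreeAlgebra K (Fin d) ⧸ Aprime K d) :=
    MvPolynomial.eval₂Hom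
      ((Ideal.Quotient.mk (Aprime K d)).comp (algebraMap K (FreeAlgebra K (Fin d))))
      fun j => Ideal.Quotient.mk (Aprime K d) (FreeAlgebra.ι K j)
  have key : ∀ g, t (ab K d g) = Ideal.Quotient.mk (Aprime K d) g := by
    intro g
    induction g using FreeAlgebra.induction with
    | grade0 r =>
      rw [AlgHom.commutes, MvPolynomial.algebraMap_eq]
      simp only [t, MvPolynomial.eval₂Hom_C]; rfl
    | grade1 x => simp [t, ab]
    | mul a b ha hb => rw [map_mul, map_mul, map_mul, ha, hb]
    | add a b ha hb => rw [map_add, map_add, map_add, ha, hb]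
  have := key f
  rw [hf, map_zero] at this
  exact Ideal.Quotient.eq_zero_iff_mem.mp this.symm

theorem mem_Aprime_iff {f : FreeAlgebra K (Fin d)} : f ∈ Aprime K d ↔ ab K d f = 0 :=
  ⟨Aprime_le_ker, ker_le_Aprime⟩

theorem ab_surj : Function.Surjective (ab K d) := by
  intro p
  induction p using MvPolynomial.induction_on with
  | C a => exact ⟨algebraMap _ _ a, by rw [AlgHom.commutes]; rfl⟩
  | add p q hp hq =>
    obtain ⟨a, rfl⟩ := hp
    obtain ⟨b, rfl⟩ := hq
    exact ⟨a + b, map_add _ _ _⟩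
  | mul_X p i hp =>
    obtain ⟨a, rfl⟩ := hp
    exact ⟨a * FreeAlgebra.ι K i, by rw [map_mul]; simp [ab]⟩

theorem exists_section : ∃ s : PolyY K d →ₗ[K] FreeAlgebra K (Fin d), ∀ p, ab K d (s p) = p := by
  obtain ⟨s, hs⟩ := (ab K d).toLinearMap.exists_rightInverse_of_surjective
    (LinearMap.range_eq_top.mpr ab_surj)
  exact ⟨s, fun p => LinearMap.congr_fun hs p⟩

theorem toU_monomial_mul_toV (m : (Fin d ⊕ Fin d) →₀ ℕ) :
    toU K d (MvPolynomial.monomial (m.comapDomain Sum.inl Sum.inl_injective.injOn) 1) *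
    toV K d (MvPolynomial.monomial (m.comapDomain Sum.inr Sum.inr_injective.injOn) 1) =
      MvPolynomial.monomial m 1 := by
  have h1 : toU K d = (MvPolynomial.rename (R := K) (Sum.inl : Fin d → Fin d ⊕ Fin d)).toRingHom := by
    apply MvPolynomial.ringHom_ext <;> intro i <;> simp [toU]
  have h2 : toV K d = (MvPolynomial.rename (R := K) (Sum.inr : Fin d → Fin d ⊕ Fin d)).toRingHom := by
    apply MvPolynomial.ringHom_ext <;> intro i <;> simp [toV]
  rw [h1, h2]
  simp only [AlgHom.toRingHom_eq_coe, RingHom.coe_coe, MvPolynomial.rename_monomial,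
    MvPolynomial.monomial_mul, mul_one]
  refine congrArg (fun z => MvPolynomial.monomial z (1 : K)) ?_
  refine Finsupp.ext fun i => ?_
  rcases i with i | i
  · rw [Finsupp.add_apply, Finsupp.mapDomain_apply Sum.inl_injective, Finsupp.mapDomain_notin_range]
    · simp [Finsupp.comapDomain_apply]
    · simp
  · rw [Finsupp.add_apply, Finsupp.mapDomain_apply Sum.inr_injective, Finsupp.mapDomain_notin_range]
    · simp [Finsupp.comapDomain_apply]
    · simp

/-- additive induction for two-sided polynomials -/
theorem poly2_induction {P : Poly2 K d → Prop} (h0 : P 0) (hadd : ∀ a b, P a → P b → P (a + b))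
    (h : ∀ p q, P (toU K d p * toV K d q)) (f : Poly2 K d) : P f := by
  induction f using MvPolynomial.induction_on' with
  | monomial m a =>
    have : MvPolynomial.monomial m a = toU K d
        (MvPolynomial.C a * MvPolynomial.monomial (m.comapDomain Sum.inl Sum.inl_injective.injOn) 1) *
        toV K d (MvPolynomial.monomial (m.comapDomain Sum.inr Sum.inr_injective.injOn) 1) := by
      rw [map_mul, mul_assoc, toU_monomial_mul_toV]
      simp [toU, MvPolynomial.C_mul_monomial]
    rw [this]; exact h _ _
  | add p q hp hq => exact hadd _ _ hp hq

theorem toU_smul (k : K) (p : PolyY K d) : toU K d (k • p) = k • toU K d p :=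
  map_smul (MvPolynomial.aeval fun j : Fin d => (MvPolynomial.X (Sum.inl j) : Poly2 K d)) k p

theorem toV_smul (k : K) (p : PolyY K d) : toV K d (k • p) = k • toV K d p :=
  map_smul (MvPolynomial.aeval fun j : Fin d => (MvPolynomial.X (Sum.inr j) : Poly2 K d)) k p

/-- Bilinear maps on `K[Y] × K[Y]` extend to `K[U,V]`. -/
theorem exists_extend {E : Type*} [AddCommGroup E] [Module K E]
    (B : PolyY K d →ₗ[K] PolyY K d →ₗ[K] E) :
    ∃ L : Poly2 K d →ₗ[K] E, ∀ p q, L (toU K d p * toV K d q) = B p q := by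
  let L : Poly2 K d →ₗ[K] E := (MvPolynomial.basisMonomials (Fin d ⊕ Fin d) K).constr K
    fun m => B (MvPolynomial.monomial (m.comapDomain Sum.inl Sum.inl_injective.injOn) 1)
      (MvPolynomial.monomial (m.comapDomain Sum.inr Sum.inr_injective.injOn) 1)
  refine ⟨L, ?_⟩
  let TU : PolyY K d →ₗ[K] Poly2 K d := ⟨⟨toU K d, map_add _⟩, toU_smul⟩
  let TV : PolyY K d →ₗ[K] Poly2 K d := ⟨⟨toV K d, map_add _⟩, toV_smul⟩
  let B' : PolyY K d →ₗ[K] PolyY K d →ₗ[K] E :=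
    (((LinearMap.mul K (Poly2 K d)).compl₁₂ TU TV).compr₂ L)
  suffices h : B' = B by
    intro p q
    rw [← h]; rfl
  refine (MvPolynomial.basisMonomials (Fin d) K).ext fun m => ?_
  refine (MvPolynomial.basisMonomials (Fin d) K).ext fun n => ?_
  simp only [MvPolynomial.coe_basisMonomials]
  have e1 : (Finsupp.sumFinsuppEquivProdFinsupp.symm (m, n)).comapDomain Sum.inl
      Sum.inl_injective.injOn = m := by
    ext i; simp [Finsupp.comapDomain_apply]
  have e2 : (Finsupp.sumFinsuppEquivProdFinsupp.symm (m, n)).comapDomain Sum.inr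
      Sum.inr_injective.injOn = n := by
    ext i; simp [Finsupp.comapDomain_apply]
  have h3 := toU_monomial_mul_toV (K := K) (Finsupp.sumFinsuppEquivProdFinsupp.symm (m, n))
  rw [e1, e2] at h3
  change L (toU K d (MvPolynomial.monomial m 1) * toV K d (MvPolynomial.monomial n 1)) = _
  rw [h3]
  have h4 := (MvPolynomial.basisMonomials (Fin d ⊕ Fin d) K).constr_basis K
    (fun m => B (MvPolynomial.monomial (m.comapDomain Sum.inl Sum.inl_injective.injOn) 1)
      (MvPolynomial.monomial (m.comapDomain Sum.inr Sum.inr_injective.injOn) 1))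
    (Finsupp.sumFinsuppEquivProdFinsupp.symm (m, n))
  rw [MvPolynomial.coe_basisMonomials, e1, e2] at h4
  exact h4

/-- the square of the commutator ideal -/
abbrev I2 (K : Type*) [Field K] (d : ℕ) : Submodule K (FreeAlgebra K (Fin d)) :=
  (Aprime K d).restrictScalars K * (Aprime K d).restrictScalars K

theorem mul_mem_I2 {a b : FreeAlgebra K (Fin d)} (ha : ab K d a = 0) (hb : ab K d b = 0) :
    a * b ∈ I2 K d :=
  Submodule.mul_mem_mul (mem_Aprime_iff.mpr ha) (mem_Aprime_iff.mpr hb)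

theorem I2_mul_right {a : FreeAlgebra K (Fin d)} (ha : a ∈ I2 K d) (r : FreeAlgebra K (Fin d)) :
    a * r ∈ I2 K d := by
  induction ha using Submodule.mul_induction_on' with
  | mem_mul_mem m hm n hn =>
    rw [mul_assoc]
    exact Submodule.mul_mem_mul hm (Aprime_mul_right hn r)
  | add x _ y _ hx hy => rw [add_mul]; exact add_mem hx hy

theorem ker_le {f : FreeAlgebra K (Fin d)} (hf : phiW K d f = 0) : f ∈ I2 K d := by
  classical
  obtain ⟨s, hs⟩ := exists_section (K := K) (d := d)
  let δ : Fin d → PolyY K d →ₗ[K] FreeAlgebra K (Fin d) := fun i =>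
    (LinearMap.mulRight K (FreeAlgebra.ι K i)).comp s -
      s.comp (LinearMap.mulRight K (MvPolynomial.X i : PolyY K d))
  have hδ : ∀ i p, δ i p = s p * FreeAlgebra.ι K i - s (p * MvPolynomial.X i) := fun i p => rfl
  have abι : ∀ i, ab K d (FreeAlgebra.ι K i) = MvPolynomial.X i := by intro i; simp [ab]
  have abδ : ∀ i p, ab K d (δ i p) = 0 := by
    intro i p; rw [hδ, map_sub, map_mul, hs, hs, abι, sub_self]
  have hex := fun i => exists_extend ((LinearMap.mul K (FreeAlgebra K (Fin d))).compl₁₂ (δ i) s)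
  choose L hL using hex
  have hL : ∀ i p q, L i (toU K d p * toV K d q) = δ i p * s q := hL
  let Ψ : Md K d → FreeAlgebra K (Fin d) := fun m => ∑ i, L i (m i)
  have Ψadd : ∀ m n, Ψ (m + n) = Ψ m + Ψ n := by
    intro m n; simp [Ψ, Finset.sum_add_distrib]
  have Ψsmul : ∀ (k : K) m, Ψ (k • m) = k • Ψ m := by
    intro m n; simp [Ψ, Finset.smul_sum]
  have Ψzero : Ψ 0 = 0 := by simp [Ψ]
  have LV : ∀ i j (m : Poly2 K d), L i (toV K d (MvPolynomial.X j) * m) - L i m * FreeAlgebra.ι K j ∈ I2 K d := by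
    intro i j m
    induction m using poly2_induction with
    | h0 => simp
    | hadd a b ha hb =>
      rw [mul_add, map_add, map_add, add_mul, add_sub_add_comm]
      exact add_mem ha hb
    | h p q =>
      have : toV K d (MvPolynomial.X j) * (toU K d p * toV K d q) =
        toU K d p * toV K d (q * MvPolynomial.X j) := by rw [map_mul]; ring
      rw [this, hL, hL, mul_assoc, ← mul_sub]
      refine mul_mem_I2 (abδ _ _) ?_
      rw [map_sub, map_mul (ab K d), hs, hs, abι, sub_self]
  have ΨV : ∀ j (m : Md K d), Ψ (MulOpposite.op (MvPolynomial.X j : PolyY K d) • m) - Ψ m * FreeAlgebra.ι K j ∈ I2 K d := by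
    intro j m
    change (∑ i, L i (toV K d (MvPolynomial.X j) * m i)) - (∑ i, L i (m i)) * _ ∈ _
    rw [Finset.sum_mul, ← Finset.sum_sub_distrib]
    exact sum_mem fun i _ => LV i j _
  have ΨU : ∀ j (p : PolyY K d), Ψ (p • (Pi.single j 1 : Md K d)) = δ j p * s 1 := by
    intro j p
    change (∑ i, L i (toU K d p * (Pi.single j 1 : Md K d) i)) = _
    rw [Finset.sum_eq_single j]
    · rw [Pi.single_eq_same, ← map_one (toV K d), hL]
    · intro i _ hi; simp [Pi.single_eq_of_ne hi]
    · simp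
  let P : FreeAlgebra K (Fin d) → Prop := fun g =>
    Ψ (phiW K d g).snd - (s 1 * g - s (ab K d g)) ∈ I2 K d
  have Padd : ∀ g h, P g → P h → P (g + h) := by
    intro g h hg hh
    have := add_mem hg hh
    simp only [P, map_add, TrivSqZeroExt.snd_add, Ψadd, mul_add]
    convert this using 1; abel
  have Psmul : ∀ (k : K) g, P g → P (k • g) := by
    intro k g hg
    have := (I2 K d).smul_mem k hg
    simp only [P, map_smul, TrivSqZeroExt.snd_smul, Ψsmul, mul_smul_comm]
    simpa only [smul_sub] using this
  have Pι : ∀ g j, P g → P (g * FreeAlgebra.ι K j) := by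
    intro g j hg
    have e : (phiW K d (g * FreeAlgebra.ι K j)).snd =
        ab K d g • (Pi.single j 1 : Md K d) +
          MulOpposite.op (MvPolynomial.X j : PolyY K d) • (phiW K d g).snd := by
      rw [map_mul, TrivSqZeroExt.snd_mul, fst_phi, fst_phi, abι]
      simp [phiW]
    simp only [P]
    rw [e, Ψadd, ΨU, map_mul, abι]
    have h1 := ΨV j (phiW K d g).snd
    have h2 := I2_mul_right hg (FreeAlgebra.ι K j)
    have h3 : δ j (ab K d g) * (s 1 - 1) ∈ I2 K d :=
      mul_mem_I2 (abδ _ _) (by rw [map_sub, hs, map_one, sub_self])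
    convert add_mem (add_mem h1 h2) h3 using 1
    rw [mul_sub, mul_one, hδ]
    noncomm_ring
  have Pmul : ∀ f g, P g → P (g * f) := by
    intro f
    induction f using FreeAlgebra.induction with
    | grade0 r =>
      intro g hg
      rw [← Algebra.commutes, ← Algebra.smul_def]; exact Psmul _ _ hg
    | grade1 x => exact fun g hg => Pι g x hg
    | mul a b ha hb => intro g hg; rw [← mul_assoc]; exact hb _ (ha _ hg)
    | add a b ha hb => intro g hg; rw [mul_add]; exact Padd _ _ (ha _ hg) (hb _ hg)
  have P1 : P 1 := by simp [P, Ψzero]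
  have hf0 : ab K d f = 0 := by rw [← fst_phi, hf]; rfl
  have hPf := Pmul f 1 P1
  simp only [P, one_mul, hf, TrivSqZeroExt.snd_zero, Ψzero, hf0, map_zero, sub_zero, zero_sub] at hPf
  have h3 : (s 1 - 1) * f ∈ I2 K d := mul_mem_I2 (by rw [map_sub, hs, map_one, sub_self]) hf0
  convert neg_mem (add_mem hPf h3) using 1
  noncomm_ring

theorem phi_mul_eq_zero {m n : FreeAlgebra K (Fin d)} (hm : ab K d m = 0) (hn : ab K d n = 0) :
    phiW K d (m * n) = 0 := by
  rw [map_mul]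
  ext1
  · rw [TrivSqZeroExt.fst_mul, fst_phi, hm, zero_mul]; rfl
  · rw [TrivSqZeroExt.snd_mul, fst_phi, fst_phi, hm, hn]; simp

theorem le_ker {f : FreeAlgebra K (Fin d)} (hf : f ∈ I2 K d) : phiW K d f = 0 := by
  induction hf using Submodule.mul_induction_on' with
  | mem_mul_mem m hm n hn => exact phi_mul_eq_zero (Aprime_le_ker hm) (Aprime_le_ker hn)
  | add x _ y _ hx hy => rw [map_add, hx, hy, add_zero]

theorem mk_I2 {f : FreeAlgebra K (Fin d)} (hf : f ∈ I2 K d) :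
    RingQuot.mkAlgHom K (MetabRel K d) f = 0 := by
  set π := RingQuot.mkAlgHom K (MetabRel K d) with hπ
  have h0 : ∀ a b c e, π ((a * b - b * a) * (c * e - e * c)) = 0 := by
    intro a b c e
    have := RingQuot.mkAlgHom_rel K (s := MetabRel K d)
      (x := (a * b - b * a) * (c * e - e * c)) (y := 0) ⟨rfl, a, b, c, e, rfl⟩
    rw [hπ, this, map_zero]
  have h1 : ∀ f g b h k, π ((f * g - g * f) * b * (h * k - k * h)) = 0 := by
    intro f g b h k
    have : (f * g - g * f) * b * (h * k - k * h) =
      (f * (g * b) - (g * b) * f) * (h * k - k * h)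
        - g * ((f * b - b * f) * (h * k - k * h)) := by noncomm_ring
    rw [this, map_sub, map_mul π g, h0, h0]; simp
  have h2 : ∀ n ∈ Aprime K d, ∀ f g b, π ((f * g - g * f) * b * n) = 0 := by
    intro n hn
    unfold Aprime at hn
    induction hn using Submodule.span_induction with
    | mem x h =>
      obtain ⟨c, h, k, e, rfl⟩ := h
      intro f g b
      have : (f * g - g * f) * b * (c * (h * k - k * h) * e) =
        ((f * g - g * f) * (b * c) * (h * k - k * h)) * e := by simp only [mul_assoc]
      rw [this, map_mul, h1, zero_mul]
    | zero => simp
    | add x y _ _ hx hy => intro f g b; rw [mul_add, map_add, hx, hy, add_zero]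
    | smul r x _ hx =>
      intro f g b
      rw [smul_eq_mul, ← mul_assoc, mul_assoc _ b r]; exact hx _ _ _
  have h3 : ∀ m ∈ Aprime K d, ∀ n ∈ Aprime K d, π (m * n) = 0 := by
    intro m hm n hn
    unfold Aprime at hm
    induction hm using Submodule.span_induction with
    | mem x h =>
      obtain ⟨c, h, k, e, rfl⟩ := h
      rw [mul_assoc c, mul_assoc c, map_mul, h2 n hn, mul_zero]
    | zero => simp
    | add x y _ _ hx hy => rw [add_mul, map_add, hx, hy, add_zero]
    | smul r x _ hx => rw [smul_eq_mul, mul_assoc, map_mul, hx, mul_zero]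
  induction hf using Submodule.mul_induction_on' with
  | mem_mul_mem m hm n hn => exact h3 m hm n hn
  | add x _ y _ hx hy => rw [map_add, hx, hy, add_zero]

end MetabEmb

/-- The kernel of `φ : A_d → W_d`, `x_j ↦ (y_j,a_j)`, is exactly `(A_d')²`;
in particular `φ` induces an embedding `ι : F_d = A_d/(A_d')² → W_d`. -/
theorem ker_phi_eq_sq_commutator_ideal
    (K : Type*) [Field K] [CharZero K] (d : ℕ) (hd : 2 ≤ d) :
    (RingHom.ker (phiW K d).toRingHom).restrictScalars K
        = (Aprime K d).restrictScalars K * (Aprime K d).restrictScalars K ∧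
      ∃ ι : FreeMetab K d →ₐ[K] Wd K d, Function.Injective ι ∧
        ι.comp (RingQuot.mkAlgHom K (MetabRel K d)) = phiW K d := by
  refine ⟨?_, ?_⟩
  · ext f
    exact ⟨fun h => MetabEmb.ker_le h, fun h => MetabEmb.le_ker h⟩
  · have hrel : ∀ ⦃x y : FreeAlgebra K (Fin d)⦄, MetabRel K d x y → phiW K d x = phiW K d y := by
      rintro x y ⟨rfl, a, b, c, e, rfl⟩
      rw [map_zero]
      apply MetabEmb.phi_mul_eq_zero
      · simp only [map_sub, map_mul]; ring
      · simp only [map_sub, map_mul]; ring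
    refine ⟨RingQuot.liftAlgHom K ⟨phiW K d, hrel⟩, ?_, ?_⟩
    · rw [injective_iff_map_eq_zero]
      intro z hz
      obtain ⟨f, rfl⟩ := RingQuot.mkAlgHom_surjective K (MetabRel K d) z
      rw [RingQuot.liftAlgHom_mkAlgHom_apply] at hz
      exact MetabEmb.mk_I2 (MetabEmb.ker_le hz)
    · ext1
      funext i
      simp [RingQuot.liftAlgHom_mkAlgHom_apply]
end
end

section
/- Assume δ(x_d) = 0 and δ maps span(x_1,…,x_{d−1}) into itself, acting there as a nilpotent linear operator, with the corresponding action on K[U_d,V_d] (so δ(u_d) = δ(v_d) = 0). Let {c_1,…,c_m} be a homogeneous generating set of the K[U_{d−1},V_{d−1}]^δ-module (F_{d−1}')^δ, and let {e_1,…,e_k, f_1,…,f_l} be a generating set of the algebra K[U_{d−1},V_{d−1}]^δ such that e_1,…,e_k do not depend on v_1,…,v_{d−1} and every monomial of each f_j has positive degree in v_1,…,v_{d−1}. Then the K[U_d,V_d]^δ-module (F_d')^δ is generated by the set {c_1,…,c_m} ∪ {π(f_1),…,π(f_l)}. -/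
noncomputable section

/-- The free generators `x_i` of `F_d`. -/
def xg (K : Type*) [CommRing K] (d : ℕ) (i : Fin d) : FreeMetab K d :=
  RingQuot.mkAlgHom K (MetabRel K d) (FreeAlgebra.ι K i)

/-- The commutator ideal `F_d'`: the two-sided ideal generated by all commutators. -/
def commIdeal (K : Type*) [CommRing K] (d : ℕ) : Ideal (FreeMetab K d) :=
  Ideal.span {z | ∃ a f g b : FreeMetab K d, z = a * (f * g - g * f) * b}

/-- `K[U_d,V_d]`. -/
abbrev PolyUV (K : Type*) [CommRing K] (d : ℕ) := MvPolynomial (Fin d ⊕ Fin d) K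

def uP (K : Type*) [CommRing K] (d : ℕ) (i : Fin d) : PolyUV K d := MvPolynomial.X (Sum.inl i)
def vP (K : Type*) [CommRing K] (d : ℕ) (i : Fin d) : PolyUV K d := MvPolynomial.X (Sum.inr i)

/-- Action of a monomial of `K[U_d,V_d]` on `F_d`, implementing
`f·u_i = x_i f` and `f·v_i = [f,x_i]` (on the commutator ideal all the
individual operators commute, so the fixed order of composition is immaterial). -/
def monAct (K : Type*) [CommRing K] (d : ℕ) (m : (Fin d ⊕ Fin d) →₀ ℕ) :
    Module.End K (FreeMetab K d) :=
  (List.ofFn fun i : Fin d =>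
      (LinearMap.mulLeft K (xg K d i) : Module.End K (FreeMetab K d)) ^ m (Sum.inl i)).prod *
  (List.ofFn fun i : Fin d =>
      (LinearMap.mulRight K (xg K d i) - LinearMap.mulLeft K (xg K d i) :
        Module.End K (FreeMetab K d)) ^ m (Sum.inr i)).prod

/-- The action of `K[U_d,V_d]` on the commutator ideal of `F_d`. -/
def act (K : Type*) [CommRing K] (d : ℕ) (p : PolyUV K d) (w : FreeMetab K d) : FreeMetab K d :=
  ∑ m ∈ p.support, p.coeff m • (monAct K d m w)

section Main

variable (K : Type*) [Field K] [CharZero K] (d : ℕ)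

/-- The subalgebra `F_{d}` of `F_{d+1}` generated by `x_1,…,x_d`. -/
def Fsmall : Subalgebra K (FreeMetab K (d + 1)) :=
  Algebra.adjoin K (Set.range fun i : Fin d => xg K (d + 1) i.castSucc)

/-- The commutator ideal of `F_d`, inside `F_{d+1}`. -/
def smallComm : Submodule K (FreeMetab K (d + 1)) :=
  Submodule.span K {z | ∃ a f g b : FreeMetab K (d + 1),
    a ∈ Fsmall K d ∧ f ∈ Fsmall K d ∧ g ∈ Fsmall K d ∧ b ∈ Fsmall K d ∧
    z = a * (f * g - g * f) * b}

/-- The set of "small" variables `u_1,…,u_d,v_1,…,v_d` of `K[U_{d+1},V_{d+1}]`. -/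
def smallSet : Set (Fin (d + 1) ⊕ Fin (d + 1)) :=
  {z | ∃ i : Fin d, z = Sum.inl i.castSucc ∨ z = Sum.inr i.castSucc}

/-- The set of small `u`-variables `u_1,…,u_d`. -/
def smallUSet : Set (Fin (d + 1) ⊕ Fin (d + 1)) :=
  {z | ∃ i : Fin d, z = Sum.inl i.castSucc}

/-- `K[U_d,V_d]_ω ⊆ K[U_{d+1},V_{d+1}]`: the span of the monomials in the small variables
of positive total degree in `v_1,…,v_d`. -/
def omegaSmall : Submodule K (PolyUV K (d + 1)) :=
  Submodule.span K {w : PolyUV K (d + 1) | ∃ m : (Fin (d + 1) ⊕ Fin (d + 1)) →₀ ℕ,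
    m (Sum.inl (Fin.last d)) = 0 ∧ m (Sum.inr (Fin.last d)) = 0 ∧
    (∃ i : Fin d, m (Sum.inr i.castSucc) ≠ 0) ∧
    w = MvPolynomial.monomial m (1 : K)}

/-- The map `π : K[U_d,V_d]_ω → F_{d+1}'`. -/
def piMapF (q : PolyUV K (d + 1)) : FreeMetab K (d + 1) :=
  ∑ m ∈ q.support, q.coeff m •
    ∑ k : Fin d, (m (Sum.inr k.castSucc)) •
      monAct K (d + 1) (m - Finsupp.single (Sum.inr k.castSucc) 1)
        (xg K (d + 1) (Fin.last d) * xg K (d + 1) k.castSucc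
          - xg K (d + 1) k.castSucc * xg K (d + 1) (Fin.last d))

/-- The homogeneous component of total degree `n` of the free metabelian algebra. -/
def degComp (n : ℕ) : Submodule K (FreeMetab K (d + 1)) :=
  Submodule.map (RingQuot.mkAlgHom K (MetabRel K (d + 1))).toLinearMap
    (Submodule.span K {w : FreeAlgebra K (Fin (d + 1)) | ∃ l : List (Fin (d + 1)),
      l.length = n ∧ w = (l.map (FreeAlgebra.ι K)).prod})


section Aux

variable {K : Type*} [Field K] {n : ℕ}

theorem F_induct {P : FreeMetab K n → Prop}
    (halg : ∀ r : K, P (algebraMap K _ r)) (hx : ∀ i, P (xg K n i))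
    (hmul : ∀ a b, P a → P b → P (a * b)) (hadd : ∀ a b, P a → P b → P (a + b)) (w : FreeMetab K n) : P w := by
  obtain ⟨w, rfl⟩ := RingQuot.mkAlgHom_surjective K (MetabRel K n) w
  induction w using FreeAlgebra.induction with
  | grade0 r => rw [AlgHom.commutes]; exact halg r
  | grade1 i => exact hx i
  | mul a b ha hb => rw [map_mul]; exact hmul _ _ ha hb
  | add a b ha hb => rw [map_add]; exact hadd _ _ ha hb

theorem comm_mul_comm (a b c e : FreeMetab K n) : (a * b - b * a) * (c * e - e * c) = 0 := by
  obtain ⟨a, rfl⟩ := RingQuot.mkAlgHom_surjective K (MetabRel K n) a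
  obtain ⟨b, rfl⟩ := RingQuot.mkAlgHom_surjective K (MetabRel K n) b
  obtain ⟨c, rfl⟩ := RingQuot.mkAlgHom_surjective K (MetabRel K n) c
  obtain ⟨e, rfl⟩ := RingQuot.mkAlgHom_surjective K (MetabRel K n) e
  have h := RingQuot.mkAlgHom_rel K (s := MetabRel K n)
    (x := (a * b - b * a) * (c * e - e * c)) (y := 0) ⟨rfl, a, b, c, e, rfl⟩
  simpa using h

theorem ring_id1 {R : Type*} [Ring R] (p q r w : R) : (p * q - q * p) * (r * w) =
    (p * (q * r) - (q * r) * p) * w - q * ((p * r - r * p) * w) := by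
  noncomm_ring

theorem ring_id2 {R : Type*} [Ring R] (a b f g p q : R) :
    a * (f * g - g * f) * b * (p * q - q * p)
      = a * ((f * g - g * f) * ((b * p) * q - q * (b * p)))
        - a * ((f * g - g * f) * (b * q - q * b)) * p := by
  noncomm_ring

theorem exists_aeval {σ A : Type*} [Semiring A] [Algebra K A] (o : σ → A)
    (h : ∀ a ∈ Set.range o, ∀ b ∈ Set.range o, a * b = b * a) :
    ∃ r : MvPolynomial σ K →ₐ[K] A, ∀ s, r (MvPolynomial.X s) = o s := by
  have := Algebra.isMulCommutative_adjoin K h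
  let _ : CommSemiring (Algebra.adjoin K (Set.range o)) :=
    { (inferInstance : Semiring (Algebra.adjoin K (Set.range o))) with
      mul_comm := fun a b => this.is_comm.comm a b }
  refine ⟨(Algebra.adjoin K (Set.range o)).val.comp
    (MvPolynomial.aeval (fun s => (⟨o s, Algebra.subset_adjoin ⟨s, rfl⟩⟩ :
      Algebra.adjoin K (Set.range o)))), fun s => ?_⟩
  simp

theorem comm_mul_mem {w : FreeMetab K n} (hw : w ∈ commIdeal K n) :
    ∀ p q, (p * q - q * p) * w = 0 := by
  unfold commIdeal at hw
  have key : ∀ w : FreeMetab K n, (∀ p q, (p * q - q * p) * w = 0) →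
      ∀ r p q, (p * q - q * p) * (r * w) = 0 := by
    intro w h r p q
    have : (p * q - q * p) * (r * w) = (p * (q * r) - (q * r) * p) * w - q * ((p * r - r * p) * w) := by
      exact ring_id1 p q r w
    rw [this, h, h]; simp
  induction hw using Submodule.span_induction with
  | mem x hx =>
    obtain ⟨a, f, g, b, rfl⟩ := hx
    intro p q
    have := key (f * g - g * f) (fun p q => comm_mul_comm p q f g) a p q
    rw [← mul_assoc, this, zero_mul]
  | zero => simp
  | add x y _ _ hx hy => intro p q; rw [mul_add, hx, hy, add_zero]
  | smul r x _ hx => intro p q; exact key x hx r p q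

theorem mem_mul_comm {w : FreeMetab K n} (hw : w ∈ commIdeal K n) :
    ∀ p q, w * (p * q - q * p) = 0 := by
  unfold commIdeal at hw
  induction hw using Submodule.span_induction with
  | mem x hx =>
    obtain ⟨a, f, g, b, rfl⟩ := hx
    intro p q
    have : a * (f * g - g * f) * b * (p * q - q * p)
      = a * ((f * g - g * f) * ((b * p) * q - q * (b * p)))
        - a * ((f * g - g * f) * (b * q - q * b)) * p := by
      exact ring_id2 a b f g p q
    rw [this, comm_mul_comm, comm_mul_comm]; simp
  | zero => simp
  | add x y _ _ hx hy => intro p q; rw [add_mul, hx, hy, add_zero]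
  | smul r x _ hx => intro p q; rw [smul_eq_mul, mul_assoc, hx, mul_zero]

theorem mem_mul_right {w : FreeMetab K n} (hw : w ∈ commIdeal K n) :
    ∀ r, w * r ∈ commIdeal K n := by
  unfold commIdeal at hw
  induction hw using Submodule.span_induction with
  | mem x hx =>
    obtain ⟨a, f, g, b, rfl⟩ := hx
    intro r
    exact Ideal.subset_span ⟨a, f, g, b * r, by noncomm_ring⟩
  | zero => simp
  | add x y _ _ hx hy => intro p; rw [add_mul]; exact add_mem (hx p) (hy p)
  | smul r x _ hx => intro p; rw [smul_eq_mul, mul_assoc]; exact Ideal.mul_mem_left _ _ (hx p)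

theorem comm_mem (f g : FreeMetab K n) : f * g - g * f ∈ commIdeal K n :=
  Ideal.subset_span ⟨1, f, g, 1, by simp⟩

variable (K n) in
/-- the commutator ideal as a `K`-space. -/
def comI : Submodule K (FreeMetab K n) := (commIdeal K n).restrictScalars K

variable (K n) in
/-- basic operators. -/
def opF : Fin n ⊕ Fin n → Module.End K (FreeMetab K n)
  | Sum.inl i => LinearMap.mulLeft K (xg K n i)
  | Sum.inr i => LinearMap.mulRight K (xg K n i) - LinearMap.mulLeft K (xg K n i)

theorem opF_mem (s : Fin n ⊕ Fin n) : ∀ w ∈ comI K n, opF K n s w ∈ comI K n := by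
  intro w hw
  have hw' : w ∈ commIdeal K n := hw
  rcases s with i | i
  · exact Ideal.mul_mem_left _ _ hw'
  · exact sub_mem (mem_mul_right hw' _) (Ideal.mul_mem_left _ _ hw')

variable (K n) in
/-- basic operators on the commutator ideal. -/
def opI (s : Fin n ⊕ Fin n) : Module.End K (comI K n) := (opF K n s).restrict (opF_mem s)

theorem opI_comm (s t : Fin n ⊕ Fin n) : opI K n s * opI K n t = opI K n t * opI K n s := by
  ext ⟨w, hw⟩
  have hl : ∀ i j, xg K n i * (xg K n j * w) = xg K n j * (xg K n i * w) := by
    intro i j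
    have := comm_mul_mem (K := K) hw (xg K n i) (xg K n j)
    rw [sub_mul, sub_eq_zero] at this
    simpa [mul_assoc] using this
  have hr : ∀ i j, w * xg K n i * xg K n j = w * xg K n j * xg K n i := by
    intro i j
    have := mem_mul_comm (K := K) hw (xg K n i) (xg K n j)
    rw [mul_sub, sub_eq_zero] at this
    simpa [mul_assoc] using this
  rcases s with i | i <;> rcases t with j | j <;>
    simp [opI, opF, mul_sub, sub_mul, mul_assoc, hl i j]
  have := hr i j
  simp only [mul_assoc] at this
  rw [this]; abel

theorem opI_comm' : ∀ a ∈ Set.range (opI K n), ∀ b ∈ Set.range (opI K n), a * b = b * a := by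
  rintro _ ⟨s, rfl⟩ _ ⟨t, rfl⟩
  exact opI_comm s t

variable (K n) in
/-- The representation of `K[U,V]` on the commutator ideal. -/
def rho : PolyUV K n →ₐ[K] Module.End K (comI K n) :=
  (exists_aeval (opI K n) opI_comm').choose

theorem rho_X (s : Fin n ⊕ Fin n) : rho K n (MvPolynomial.X s) = opI K n s :=
  (exists_aeval (opI K n) opI_comm').choose_spec s

theorem rho_inl (i : Fin n) (w : comI K n) :
    (rho K n (MvPolynomial.X (Sum.inl i)) w : FreeMetab K n) = xg K n i * w := by
  rw [rho_X]; rfl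

theorem rho_inr (i : Fin n) (w : comI K n) :
    (rho K n (MvPolynomial.X (Sum.inr i)) w : FreeMetab K n) = w * xg K n i - xg K n i * w := by
  rw [rho_X]; rfl

theorem list_compat {ι : Type*} (A : ι → Module.End K (comI K n)) (B : ι → Module.End K (FreeMetab K n))
    (h : ∀ i w, (A i w : FreeMetab K n) = B i w) (l : List ι) (w : comI K n) :
    ((l.map A).prod w : FreeMetab K n) = (l.map B).prod w := by
  induction l generalizing w with
  | nil => simp
  | cons a l ih => simp [ih, h]

theorem pow_compat (A : Module.End K (comI K n)) (B : Module.End K (FreeMetab K n))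
    (h : ∀ w, (A w : FreeMetab K n) = B w) (e : ℕ) (w : comI K n) :
    ((A ^ e) w : FreeMetab K n) = (B ^ e) w := by
  induction e generalizing w with
  | zero => simp
  | succ e ih => simp [pow_succ, ih, h]

theorem rho_monomial (m : (Fin n ⊕ Fin n) →₀ ℕ) (w : comI K n) :
    (rho K n (MvPolynomial.monomial m 1) w : FreeMetab K n) = monAct K n m w := by
  have hm : (MvPolynomial.monomial m (1 : K)) =
      (List.ofFn fun i : Fin n => (MvPolynomial.X (Sum.inl i) : PolyUV K n) ^ m (Sum.inl i)).prod *
      (List.ofFn fun i : Fin n => (MvPolynomial.X (Sum.inr i) : PolyUV K n) ^ m (Sum.inr i)).prod := by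
    rw [List.prod_ofFn, List.prod_ofFn, ← Fintype.prod_sum_type
      (f := fun s => (MvPolynomial.X s : PolyUV K n) ^ m s), MvPolynomial.monomial_eq,
      Finsupp.prod_fintype _ _ (by simp)]
    simp
  rw [hm, map_mul, map_list_prod, map_list_prod]
  unfold monAct
  simp only [List.ofFn_eq_map, List.map_map]
  rw [Module.End.mul_apply, Module.End.mul_apply,
    list_compat _ (fun i : Fin n => (LinearMap.mulLeft K (xg K n i) : Module.End K (FreeMetab K n)) ^ m (Sum.inl i)),
    list_compat _ (fun i : Fin n => (LinearMap.mulRight K (xg K n i) - LinearMap.mulLeft K (xg K n i) :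
        Module.End K (FreeMetab K n)) ^ m (Sum.inr i))]
  · intro i w
    simp only [Function.comp, map_pow]
    apply pow_compat
    intro w; exact rho_inr i w
  · intro i w
    simp only [Function.comp, map_pow]
    apply pow_compat
    intro w; exact rho_inl i w

theorem act_eq (p : PolyUV K n) (w : comI K n) :
    act K n p w = (rho K n p w : FreeMetab K n) := by
  conv_rhs => rw [p.as_sum]
  unfold act
  rw [map_sum, LinearMap.sum_apply, AddSubmonoidClass.coe_finsetSum]
  refine Finset.sum_congr rfl fun m _ => ?_
  rw [← rho_monomial]
  conv_rhs => rw [show MvPolynomial.monomial m (p.coeff m) = p.coeff m • MvPolynomial.monomial m (1:K) by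
    simp [MvPolynomial.smul_monomial]]
  rw [map_smul]; rfl

variable (K n) in
/-- The commutator `[x_i,x_j]`. -/
def cc (i j : Fin n) : comI K n :=
  ⟨xg K n i * xg K n j - xg K n j * xg K n i, comm_mem _ _⟩

end Aux

section Aux2

variable {K : Type*} [Field K] {n : ℕ}

/-- coordinates of the triangular embedding, on the free algebra. -/
def Phi0 (K : Type*) [Field K] (n : ℕ) (l : Fin n) :
    FreeAlgebra K (Fin n) →ₐ[K] Matrix (Fin 2) (Fin 2) (PolyUV K n) :=
  FreeAlgebra.lift K (fun j => !![uP K n j, if l = j then 1 else 0; 0, uP K n j + vP K n j])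

theorem mat2_mul {R : Type*} [CommRing R] (A B : Matrix (Fin 2) (Fin 2) R) (i j : Fin 2) :
    (A * B) i j = A i 0 * B 0 j + A i 1 * B 1 j := by
  simp [Matrix.mul_apply, Fin.sum_univ_two]

theorem Phi0_low (l : Fin n) (a : FreeAlgebra K (Fin n)) : Phi0 K n l a 1 0 = 0 := by
  induction a using FreeAlgebra.induction with
  | grade0 r => rw [AlgHom.commutes]; simp [Matrix.algebraMap_matrix_apply]
  | grade1 i => simp [Phi0]
  | mul a b ha hb => rw [map_mul, mat2_mul, ha, hb]; simp
  | add a b ha hb => rw [map_add, Matrix.add_apply, ha, hb]; simp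

theorem Phi0_rel (l : Fin n) ⦃x y : FreeAlgebra K (Fin n)⦄ (h : MetabRel K n x y) :
    Phi0 K n l x = Phi0 K n l y := by
  obtain ⟨rfl, a, b, c, e, rfl⟩ := h
  have ha := Phi0_low l a
  have hb := Phi0_low l b
  have hc := Phi0_low l c
  have he := Phi0_low l e
  simp only [map_mul, map_sub, map_zero]
  ext i j
  congr 1
  fin_cases i <;> fin_cases j <;>
  simp [mat2_mul, ha, hb, hc, he] <;> ring_nf <;> simp

/-- coordinates of the triangular embedding. -/
def Phi (K : Type*) [Field K] (n : ℕ) (l : Fin n) :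
    FreeMetab K n →ₐ[K] Matrix (Fin 2) (Fin 2) (PolyUV K n) :=
  RingQuot.liftAlgHom K ⟨Phi0 K n l, Phi0_rel l⟩

theorem Phi_x (l j : Fin n) : Phi K n l (xg K n j) =
    !![uP K n j, if l = j then 1 else 0; 0, uP K n j + vP K n j] := by
  simp [Phi, xg, Phi0]

theorem Phi_low (l : Fin n) (a : FreeMetab K n) : Phi K n l a 1 0 = 0 := by
  obtain ⟨a, rfl⟩ := RingQuot.mkAlgHom_surjective K (MetabRel K n) a
  simpa [Phi] using Phi0_low l a

theorem Phi_00 (l : Fin n) (a b : FreeMetab K n) : Phi K n l (a * b) 0 0 = Phi K n l a 0 0 * Phi K n l b 0 0 := by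
  rw [map_mul, mat2_mul, Phi_low]; simp
theorem Phi_01 (l : Fin n) (a b : FreeMetab K n) : Phi K n l (a * b) 0 1 =
    Phi K n l a 0 0 * Phi K n l b 0 1 + Phi K n l a 0 1 * Phi K n l b 1 1 := by
  rw [map_mul, mat2_mul]
theorem Phi_11 (l : Fin n) (a b : FreeMetab K n) : Phi K n l (a * b) 1 1 = Phi K n l a 1 1 * Phi K n l b 1 1 := by
  rw [map_mul, mat2_mul, Phi_low]; simp

theorem Phi_mem (l : Fin n) {w : FreeMetab K n} (hw : w ∈ commIdeal K n) :
    Phi K n l w 0 0 = 0 ∧ Phi K n l w 1 1 = 0 := by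
  unfold commIdeal at hw
  induction hw using Submodule.span_induction with
  | mem x hx =>
    obtain ⟨a, f, g, b, rfl⟩ := hx
    simp only [Phi_00, Phi_11, map_sub, Matrix.sub_apply]
    constructor <;> ring
  | zero => simp
  | add x y _ _ hx hy => simp [hx, hy]
  | smul r x _ hx => simp only [smul_eq_mul, Phi_00, Phi_11, hx]; simp

/-- The coordinates of the embedding of the commutator ideal. -/
def phi (K : Type*) [Field K] (n : ℕ) (l : Fin n) : comI K n →ₗ[K] PolyUV K n :=
  (Matrix.entryLinearMap K (PolyUV K n) (0 : Fin 2) (1 : Fin 2)) ∘ₗ (Phi K n l).toLinearMap ∘ₗ (comI K n).subtype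

theorem phi_apply (l : Fin n) (w : comI K n) : phi K n l w = Phi K n l w 0 1 := rfl

theorem phi_rho (l : Fin n) (p : PolyUV K n) (w : comI K n) :
    phi K n l (rho K n p w) = p * phi K n l w := by
  induction p using MvPolynomial.induction_on generalizing w with
  | C a =>
    rw [← MvPolynomial.algebraMap_eq, AlgHom.commutes, Module.algebraMap_end_apply, map_smul, Algebra.smul_def]
  | add p q hp hq => rw [map_add, LinearMap.add_apply, map_add, hp, hq, add_mul]
  | mul_X p s hp =>
    rw [map_mul, Module.End.mul_apply, hp, mul_assoc]
    congr 1
    obtain ⟨h0, h1⟩ := Phi_mem l (w := (w : FreeMetab K n)) w.2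
    rcases s with i | i
    · rw [phi_apply, rho_inl, Phi_01, h1, Phi_x, phi_apply]; simp [uP]
    · rw [phi_apply, rho_inr, map_sub, Matrix.sub_apply, Phi_01, Phi_01, h1, h0, Phi_x, phi_apply]
      simp [uP, vP]; ring

theorem phi_cc (l i j : Fin n) : phi K n l (cc K n i j) =
    (if l = i then vP K n j else 0) - (if l = j then vP K n i else 0) := by
  rw [phi_apply, cc]
  simp only [map_sub, Matrix.sub_apply, Phi_01, Phi_x]
  simp
  split_ifs <;> ring

variable (K n) in
/-- the span of the generators -/
def genN : Submodule K (comI K n) :=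
  Submodule.span K (Set.range fun t : PolyUV K n × Fin n × Fin n => rho K n t.1 (cc K n t.2.1 t.2.2))

theorem genN_rho (p : PolyUV K n) {w : comI K n} (hw : w ∈ genN K n) : rho K n p w ∈ genN K n := by
  unfold genN at hw ⊢
  induction hw using Submodule.span_induction with
  | mem x hx =>
    obtain ⟨⟨q, i, j⟩, rfl⟩ := hx
    refine Submodule.subset_span ⟨⟨p * q, i, j⟩, ?_⟩
    simp
  | zero => simp
  | add x y _ _ hx hy => rw [map_add]; exact add_mem hx hy
  | smul r x _ hx => rw [map_smul]; exact Submodule.smul_mem _ _ hx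

variable (K n) in
/-- the span of the generators, in the algebra -/
def genN' : Submodule K (FreeMetab K n) := (genN K n).map (comI K n).subtype

theorem genN'_x {z : FreeMetab K n} (hz : z ∈ genN' K n) (i : Fin n) :
    xg K n i * z ∈ genN' K n ∧ z * xg K n i ∈ genN' K n := by
  obtain ⟨w, hw, rfl⟩ := hz
  have h1 : xg K n i * (w : FreeMetab K n) ∈ genN' K n :=
    ⟨_, genN_rho (MvPolynomial.X (Sum.inl i)) hw, rho_inl i w⟩
  refine ⟨h1, ?_⟩
  have h2 : (w : FreeMetab K n) * xg K n i - xg K n i * w ∈ genN' K n :=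
    ⟨_, genN_rho (MvPolynomial.X (Sum.inr i)) hw, rho_inr i w⟩
  have := add_mem h2 h1
  rwa [sub_add_cancel] at this

theorem genN'_mul (r : FreeMetab K n) : ∀ z ∈ genN' K n, r * z ∈ genN' K n ∧ z * r ∈ genN' K n := by
  induction r using F_induct with
  | halg r =>
    intro z hz
    rw [← Algebra.commutes, ← Algebra.smul_def]
    exact ⟨Submodule.smul_mem _ _ hz, Submodule.smul_mem _ _ hz⟩
  | hx i => intro z hz; exact genN'_x hz i
  | hmul a b ha hb =>
    intro z hz
    rw [mul_assoc, ← mul_assoc z]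
    exact ⟨(ha _ (hb _ hz).1).1, (hb _ (ha _ hz).2).2⟩
  | hadd a b ha hb =>
    intro z hz
    rw [add_mul, mul_add]
    exact ⟨add_mem (ha _ hz).1 (hb _ hz).1, add_mem (ha _ hz).2 (hb _ hz).2⟩

theorem ring_id3 {R : Type*} [Ring R] (a b g : R) : a * b * g - g * (a * b) =
    a * (b * g - g * b) + (a * g - g * a) * b := by noncomm_ring
theorem ring_id4 {R : Type*} [Ring R] (a b g : R) : g * (a * b) - a * b * g =
    a * (g * b - b * g) + (g * a - a * g) * b := by noncomm_ring
theorem ring_id5 {R : Type*} [Ring R] (a b g : R) : (a + b) * g - g * (a + b) =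
    (a * g - g * a) + (b * g - g * b) := by noncomm_ring
theorem ring_id6 {R : Type*} [Ring R] (a b g : R) : g * (a + b) - (a + b) * g =
    (g * a - a * g) + (g * b - b * g) := by noncomm_ring

theorem genN'_comm (f g : FreeMetab K n) : f * g - g * f ∈ genN' K n := by
  induction f using F_induct with
  | halg r => rw [Algebra.commutes, sub_self]; exact zero_mem _
  | hmul a b ha hb =>
    rw [ring_id3]
    exact add_mem (genN'_mul a _ hb).1 (genN'_mul b _ ha).2
  | hadd a b ha hb => rw [ring_id5]; exact add_mem ha hb
  | hx i =>
    induction g using F_induct with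
    | halg r => rw [Algebra.commutes, sub_self]; exact zero_mem _
    | hmul a b ha hb =>
      rw [ring_id4]
      exact add_mem (genN'_mul a _ hb).1 (genN'_mul b _ ha).2
    | hadd a b ha hb => rw [ring_id6]; exact add_mem ha hb
    | hx j =>
      refine ⟨cc K n i j, Submodule.subset_span ⟨⟨1, i, j⟩, ?_⟩, rfl⟩
      simp

theorem genN_top : genN K n = ⊤ := by
  rw [eq_top_iff]
  rintro ⟨w, hw⟩ -
  have hw' : w ∈ commIdeal K n := hw
  have : w ∈ genN' K n := by
    clear hw
    unfold commIdeal at hw'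
    induction hw' using Submodule.span_induction with
    | mem x hx =>
      obtain ⟨a, f, g, b, rfl⟩ := hx
      exact (genN'_mul b _ (genN'_mul a _ (genN'_comm f g)).1).2
    | zero => exact zero_mem _
    | add x y _ _ hx hy => exact add_mem hx hy
    | smul r x _ hx => exact (genN'_mul r _ hx).1
  obtain ⟨z, hz, h⟩ := this
  have : z = ⟨w, hw⟩ := Subtype.ext h
  rwa [← this]

theorem comI_ext {V : Type*} [AddCommMonoid V] [Module K V] (f g : comI K n →ₗ[K] V)
    (h : ∀ p i j, f (rho K n p (cc K n i j)) = g (rho K n p (cc K n i j))) (w : comI K n) : f w = g w := by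
  have : f = g := by
    apply LinearMap.ext_on (genN_top (K := K) (n := n))
    rintro _ ⟨⟨p, i, j⟩, rfl⟩
    exact h p i j
  rw [this]

theorem ring_id7 {R : Type*} [Ring R] (a b c : R) :
    ((a * c - c * a) * b - b * (a * c - c * a)) + ((c * b - b * c) * a - a * (c * b - b * c))
      = (a * b - b * a) * c - c * (a * b - b * a) := by noncomm_ring

theorem rho_jacobi (i j k : Fin n) :
    rho K n (vP K n j) (cc K n i k) + rho K n (vP K n i) (cc K n k j) = rho K n (vP K n k) (cc K n i j) := by
  apply Subtype.ext
  rw [Submodule.coe_add]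
  unfold vP
  rw [rho_inr, rho_inr, rho_inr]
  exact ring_id7 _ _ _
end Aux2

section Aux3

variable {K : Type*} [Field K] {n : ℕ}

theorem der_sum_apply {ι A : Type*} [CommRing A] [Algebra K A] (s : Finset ι) (D : ι → Derivation K A A) (q : A) :
    (∑ i ∈ s, D i) q = ∑ i ∈ s, D i q := by
  classical
  induction s using Finset.induction_on with
  | empty => simp
  | insert a s ha ih => rw [Finset.sum_insert ha, Finset.sum_insert ha, Derivation.add_apply, ih]

/-- diagonal operators on polynomials. -/
def diagOp (g : ((Fin n ⊕ Fin n) →₀ ℕ) → K) : PolyUV K n →ₗ[K] PolyUV K n :=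
  (MvPolynomial.basisMonomials (Fin n ⊕ Fin n) K).constr K (fun m => MvPolynomial.monomial m (g m))

theorem diagOp_monomial (g : ((Fin n ⊕ Fin n) →₀ ℕ) → K) (m) (a : K) :
    diagOp g (MvPolynomial.monomial m a) = MvPolynomial.monomial m (g m * a) := by
  have h := (MvPolynomial.basisMonomials (Fin n ⊕ Fin n) K).constr_basis K
    (fun m => MvPolynomial.monomial m (g m)) m
  rw [MvPolynomial.coe_basisMonomials] at h
  have h2 : MvPolynomial.monomial m a = a • MvPolynomial.monomial m (1 : K) := by
    simp [MvPolynomial.smul_monomial]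
  rw [h2, map_smul, diagOp, h, MvPolynomial.smul_monomial, smul_eq_mul, mul_comm]

theorem diagOp_coeff (g : ((Fin n ⊕ Fin n) →₀ ℕ) → K) (m) (q : PolyUV K n) :
    (diagOp g q).coeff m = g m * q.coeff m := by
  classical
  induction q using MvPolynomial.induction_on' with
  | monomial s a =>
    rw [diagOp_monomial, MvPolynomial.coeff_monomial, MvPolynomial.coeff_monomial]
    split_ifs with h
    · rw [h]
    · simp
  | add p q hp hq => rw [map_add, MvPolynomial.coeff_add, MvPolynomial.coeff_add, hp, hq, mul_add]

/-- partial degree. -/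
def degJ (J : Finset (Fin n)) (m : (Fin n ⊕ Fin n) →₀ ℕ) : ℕ := ∑ k ∈ J, m (Sum.inr k)

variable (K) in
/-- partial Euler derivation. -/
def Eul (J : Finset (Fin n)) : Derivation K (PolyUV K n) (PolyUV K n) :=
  ∑ k ∈ J, vP K n k • MvPolynomial.pderiv (Sum.inr k)

theorem Eul_apply (J : Finset (Fin n)) (q : PolyUV K n) :
    Eul K J q = ∑ k ∈ J, vP K n k * MvPolynomial.pderiv (Sum.inr k) q := by
  unfold Eul
  rw [der_sum_apply]
  rfl

theorem Eul_monomial (J : Finset (Fin n)) (m) (a : K) :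
    Eul K J (MvPolynomial.monomial m a) = MvPolynomial.monomial m ((degJ J m : K) * a) := by
  rw [Eul_apply, degJ, Nat.cast_sum, Finset.sum_mul, map_sum]
  refine Finset.sum_congr rfl fun k _ => ?_
  rw [MvPolynomial.pderiv_monomial, vP, MvPolynomial.X, MvPolynomial.monomial_mul]
  by_cases h : m (Sum.inr k) = 0
  · simp [h]
  · rw [add_tsub_cancel_of_le]
    · congr 1; ring
    · rw [Finsupp.single_le_iff]; omega

theorem Eul_eq (J : Finset (Fin n)) (q : PolyUV K n) :
    Eul K J q = diagOp (fun m => (degJ J m : K)) q := by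
  induction q using MvPolynomial.induction_on' with
  | monomial s a => rw [diagOp_monomial, Eul_monomial]
  | add p q hp hq => rw [map_add, map_add, hp, hq]

variable (K) in
/-- inverse of the shifted Euler operator. -/
def Ls (J : Finset (Fin n)) (s : ℕ) : PolyUV K n →ₗ[K] PolyUV K n :=
  diagOp (fun m => ((degJ J m + s : ℕ) : K)⁻¹)

theorem Ls_v (J : Finset (Fin n)) (s : ℕ) {j : Fin n} (hj : j ∈ J) (q : PolyUV K n) :
    Ls K J s (vP K n j * q) = vP K n j * Ls K J (s + 1) q := by
  induction q using MvPolynomial.induction_on' with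
  | monomial m a =>
    rw [vP, MvPolynomial.X, MvPolynomial.monomial_mul, Ls, Ls, diagOp_monomial, diagOp_monomial,
      MvPolynomial.monomial_mul]
    have : degJ J (Finsupp.single (Sum.inr j) 1 + m) = degJ J m + 1 := by
      simp [degJ, Finset.sum_add_distrib, Finsupp.single_apply, hj]
      ring
    rw [this]
    congr 1
    rw [show degJ J m + 1 + s = degJ J m + (s + 1) by ring]
    ring
  | add p q hp hq => rw [mul_add, map_add, map_add, hp, hq, mul_add]

theorem Eul_Ls [CharZero K] (J : Finset (Fin n)) (s : ℕ) (q : PolyUV K n) :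
    Eul K J (Ls K J (s + 1) q) + ((s + 1 : ℕ) : K) • Ls K J (s + 1) q = q := by
  rw [Eul_eq]
  ext m
  rw [MvPolynomial.coeff_add, MvPolynomial.coeff_smul, diagOp_coeff, Ls, diagOp_coeff, smul_eq_mul,
    ← add_mul, ← mul_assoc, ← Nat.cast_add, mul_inv_cancel₀, one_mul]
  exact_mod_cast (by omega : degJ J m + (s + 1) ≠ 0)

theorem Eul_v (J : Finset (Fin n)) (j : Fin n) :
    Eul K J (vP K n j) = if j ∈ J then vP K n j else 0 := by
  classical
  simp [Eul_apply, vP, MvPolynomial.pderiv_X, Pi.single_apply]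

theorem Eul_u (J : Finset (Fin n)) (j : Fin n) :
    Eul K J (uP K n j) = 0 := by
  classical
  simp [Eul_apply, uP, MvPolynomial.pderiv_X, Pi.single_apply]

theorem Eul_Ls0 [CharZero K] (J : Finset (Fin n)) {j : Fin n} (hj : j ∈ J) (q : PolyUV K n) :
    Eul K J (Ls K J 0 (vP K n j * q)) = vP K n j * q := by
  rw [Ls_v J 0 hj, Derivation.leibniz, Eul_v, if_pos hj]
  have := Eul_Ls J 0 q
  conv_rhs => rw [← this]
  simp [smul_eq_mul]
  ring

theorem Ls_comm [CharZero K] (J : Finset (Fin n)) (D : PolyUV K n →ₗ[K] PolyUV K n)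
    (hD : ∀ q, D (Eul K J q) = Eul K J (D q)) (s : ℕ) (q : PolyUV K n) :
    D (Ls K J s q) = Ls K J s (D q) := by
  induction q using MvPolynomial.induction_on' with
  | monomial m a =>
    have h := hD (MvPolynomial.monomial m a)
    rw [Eul_monomial, Eul_eq, ← smul_eq_mul, ← MvPolynomial.smul_monomial, map_smul] at h
    rw [Ls, diagOp_monomial, ← smul_eq_mul, ← MvPolynomial.smul_monomial, map_smul]
    ext m'
    have h' := congrArg (MvPolynomial.coeff m') h
    rw [MvPolynomial.coeff_smul, diagOp_coeff, smul_eq_mul] at h'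
    rw [MvPolynomial.coeff_smul, diagOp_coeff, smul_eq_mul]
    rcases mul_eq_mul_right_iff.1 h' with h1 | h1
    · rw [Nat.cast_inj] at h1; rw [h1]
    · rw [h1]; simp
  | add p q hp hq => simp only [map_add, hp, hq]

/-- evaluate `rho` at a vector -/
def rhoAt (c : comI K n) : PolyUV K n →ₗ[K] comI K n where
  toFun p := rho K n p c
  map_add' p q := by simp
  map_smul' p q := by simp

theorem pderiv_v (k j : Fin n) (q : PolyUV K n) : MvPolynomial.pderiv (Sum.inr k) (vP K n j * q) =
    vP K n j * MvPolynomial.pderiv (Sum.inr k) q + if k = j then q else 0 := by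
  classical
  rw [MvPolynomial.pderiv_mul, vP, MvPolynomial.pderiv_X, Pi.single_apply]
  by_cases h : k = j
  · simp [h]; ring
  · simp [h, Ne.symm h]

theorem cc_swap (i j : Fin n) : cc K n i j + cc K n j i = 0 := by
  apply Subtype.ext
  rw [Submodule.coe_add]
  simp [cc]

theorem cancel_smul {V : Type*} [AddCommMonoid V] [Module K V] (B : V) : B + (-1 : K) • B = 0 := by
  have : (1 : K) • B + (-1 : K) • B = 0 := by rw [← add_smul]; simp
  rwa [one_smul] at this

theorem cc_neg (i j : Fin n) : cc K n i j = (-1 : K) • cc K n j i := by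
  have h := cancel_smul (K := K) (cc K n j i)
  calc cc K n i j = cc K n i j + (cc K n j i + (-1 : K) • cc K n j i) := by rw [h, add_zero]
    _ = (cc K n i j + cc K n j i) + (-1 : K) • cc K n j i := by rw [add_assoc]
    _ = _ := by rw [cc_swap, zero_add]

theorem sum_rho (G : PolyUV K n) (a b : Fin n) :
    ∑ k, rho K n (MvPolynomial.pderiv (Sum.inr k) (vP K n b * G)) (cc K n a k) =
      ∑ k, rho K n (MvPolynomial.pderiv (Sum.inr k) (vP K n a * G)) (cc K n b k) +
      rho K n (Eul K Finset.univ G + (2 : ℕ) • G) (cc K n a b) := by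
  simp only [pderiv_v, map_add, LinearMap.add_apply, Finset.sum_add_distrib]
  have h1 : ∀ a b, ∑ x, rho K n (if x = b then G else 0) (cc K n a x) = rho K n G (cc K n a b) := by
    intro a b
    rw [Finset.sum_eq_single b]
    · simp
    · intro x _ hx; simp [hx]
    · simp
  rw [h1, h1, Eul_apply, map_sum, LinearMap.sum_apply, cc_neg b a, two_smul, map_add, LinearMap.add_apply,
    map_smul]
  have h2 : ∀ x, rho K n (vP K n b * MvPolynomial.pderiv (Sum.inr x) G) (cc K n a x) =
     rho K n (vP K n a * MvPolynomial.pderiv (Sum.inr x) G) (cc K n b x) +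
     rho K n (vP K n x * MvPolynomial.pderiv (Sum.inr x) G) (cc K n a b) := by
    intro x
    rw [mul_comm (vP K n b), mul_comm (vP K n a), mul_comm (vP K n x)]
    simp only [map_mul, Module.End.mul_apply]
    rw [← map_add, ← rho_jacobi a b x, cc_neg x b, map_smul, add_left_comm, cancel_smul, add_zero]
  simp only [h2, Finset.sum_add_distrib]
  generalize ∑ x, rho K n (vP K n a * MvPolynomial.pderiv (Sum.inr x) G) (cc K n b x) = S
  generalize ∑ x, rho K n (vP K n x * MvPolynomial.pderiv (Sum.inr x) G) (cc K n a b) = T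
  generalize rho K n G (cc K n a b) = U
  have := cancel_smul (K := K) U
  calc S + T + U = S + T + U + 0 := by rw [add_zero]
    _ = S + T + U + (U + (-1 : K) • U) := by rw [this]
    _ = _ := by ac_rfl

theorem psi_phi [CharZero K] (w : comI K n) :
    ∑ i, ∑ k, rho K n (MvPolynomial.pderiv (Sum.inr k) (Ls K Finset.univ 1 (phi K n i w))) (cc K n i k) = w := by
  have h := comI_ext (∑ i, ∑ k, (rhoAt (cc K n i k)) ∘ₗ
    (MvPolynomial.pderiv (R := K) (Sum.inr k : Fin n ⊕ Fin n)).toLinearMap ∘ₗ (Ls K Finset.univ 1) ∘ₗ phi K n i)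
    LinearMap.id ?_ w
  · simpa [LinearMap.sum_apply, rhoAt] using h
  intro p a b
  simp only [LinearMap.sum_apply, LinearMap.comp_apply, LinearMap.id_apply, rhoAt, LinearMap.coe_mk,
    AddHom.coe_mk, phi_rho, phi_cc, Derivation.coeFn_coe]
  have hE := Eul_Ls (K := K) Finset.univ 1 p
  have h1 : ∀ i, Ls K Finset.univ 1 (p * ((if i = a then vP K n b else 0) - if i = b then vP K n a else 0))
    = (if i = a then vP K n b * Ls K Finset.univ 2 p else 0) + (-1 : K) • (if i = b then vP K n a * Ls K Finset.univ 2 p else 0) := by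
    intro i
    rw [mul_sub, map_sub, neg_one_smul, ← sub_eq_add_neg]
    congr 1
    · split_ifs
      · rw [mul_comm, Ls_v _ _ (Finset.mem_univ _)]
      · simp
    · split_ifs
      · rw [mul_comm, Ls_v _ _ (Finset.mem_univ _)]
      · simp
  simp only [h1, map_add, map_smul, Derivation.map_smul, LinearMap.add_apply, LinearMap.smul_apply, Finset.sum_add_distrib, ← Finset.smul_sum]
  have h2 : ∀ (a : Fin n) (Q : PolyUV K n), ∑ i, ∑ k, rho K n (MvPolynomial.pderiv (Sum.inr k) (if i = a then Q else 0)) (cc K n i k)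
      = ∑ k, rho K n (MvPolynomial.pderiv (Sum.inr k) Q) (cc K n a k) := by
    intro a Q
    rw [Finset.sum_eq_single a]
    · simp
    · intro x _ hx; simp [hx]
    · simp
  rw [h2, h2, sum_rho, add_right_comm, cancel_smul, zero_add]
  congr 2
  conv_rhs => rw [← hE]
  rw [Nat.cast_smul_eq_nsmul]

theorem phi_inj [CharZero K] {w z : comI K n} (h : ∀ i, phi K n i w = phi K n i z) : w = z := by
  rw [← psi_phi w, ← psi_phi z]
  simp only [h]

theorem phi_koszul (w : comI K n) : ∑ i, vP K n i * phi K n i w = 0 := by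
  have h := comI_ext (∑ i, (LinearMap.mulLeft K (vP K n i)) ∘ₗ phi K n i) 0 ?_ w
  · simpa [LinearMap.sum_apply] using h
  intro p a b
  simp only [LinearMap.sum_apply, LinearMap.comp_apply, LinearMap.mulLeft_apply, phi_rho, phi_cc, LinearMap.zero_apply]
  simp [mul_sub]
  ring

theorem phi_psi (J : Finset (Fin n)) (σ : Fin n → PolyUV K n) (h0 : ∀ i, i ∉ J → σ i = 0)
    (hk : ∑ i, vP K n i * σ i = 0) (j : Fin n) :
    phi K n j (∑ i, ∑ k ∈ J, rho K n (MvPolynomial.pderiv (Sum.inr k) (σ i)) (cc K n i k)) =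
      if j ∈ J then Eul K J (σ j) + σ j else 0 := by
  simp only [map_sum, phi_rho, phi_cc, mul_sub, Finset.sum_sub_distrib]
  have h1 : ∑ i, ∑ k ∈ J, MvPolynomial.pderiv (Sum.inr k) (σ i) * (if j = i then vP K n k else 0) = Eul K J (σ j) := by
    rw [Finset.sum_eq_single j]
    · simp [Eul_apply, mul_comm]
    · intro x _ hx; simp [Ne.symm hx]
    · simp
  have h2 : ∑ i, ∑ k ∈ J, MvPolynomial.pderiv (Sum.inr k) (σ i) * (if j = k then vP K n i else 0) =
     if j ∈ J then - σ j else 0 := by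
    split_ifs with hj
    · have : ∀ i, ∑ k ∈ J, MvPolynomial.pderiv (Sum.inr k) (σ i) * (if j = k then vP K n i else 0)
          = vP K n i * MvPolynomial.pderiv (Sum.inr j) (σ i) := by
        intro i
        simp [hj, mul_comm]
      simp only [this]
      have h3 := congrArg (MvPolynomial.pderiv (Sum.inr j)) hk
      simp only [map_sum, pderiv_v, Finset.sum_add_distrib, map_zero] at h3
      simp at h3
      exact eq_neg_of_add_eq_zero_left h3
    · apply Finset.sum_eq_zero; intro i _
      apply Finset.sum_eq_zero; intro k hk
      rw [if_neg (by rintro rfl; exact hj hk)]; simp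
  rw [h1, h2]
  split_ifs with hj
  · ring
  · rw [h0 j hj]; simp

theorem Phi_indep (l l' : Fin n) (w : FreeMetab K n) :
    Phi K n l w 0 0 = Phi K n l' w 0 0 ∧ Phi K n l w 1 1 = Phi K n l' w 1 1 := by
  induction w using F_induct with
  | halg r => simp [AlgHom.commutes, Matrix.algebraMap_matrix_apply]
  | hx i => simp [Phi_x]
  | hmul a b ha hb => simp only [Phi_00, Phi_11, ha, hb]; simp
  | hadd a b ha hb => simp [ha, hb]

section delta
variable (β : Matrix (Fin n) (Fin n) K)
    (δB : FreeMetab K n →ₗ[K] FreeMetab K n)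
    (hleib : ∀ a b : FreeMetab K n, δB (a * b) = δB a * b + a * δB b)
    (hδx : ∀ j, δB (xg K n j) = ∑ i, β i j • xg K n i)
    (δ' : Derivation K (PolyUV K n) (PolyUV K n))
    (hu : ∀ j, δ' (uP K n j) = ∑ i, β i j • uP K n i)
    (hv : ∀ j, δ' (vP K n j) = ∑ i, β i j • vP K n i)

include hleib in
theorem delta_one : δB 1 = 0 := by
  have := hleib 1 1
  simpa using this

theorem ring_id8 {R : Type*} [Ring R] (a b f g a' b' f' g' : R) :
    (a' * (f * g - g * f) + a * (f' * g + f * g' - (g' * f + g * f'))) * b + a * (f * g - g * f) * b'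
     = a' * (f * g - g * f) * b + a * (f' * g - g * f') * b
        + a * (f * g' - g' * f) * b + a * (f * g - g * f) * b' := by noncomm_ring

include hleib in
theorem delta_mem {w : FreeMetab K n} (hw : w ∈ commIdeal K n) : δB w ∈ commIdeal K n := by
  unfold commIdeal at hw
  induction hw using Submodule.span_induction with
  | mem x hx =>
    obtain ⟨a, f, g, b, rfl⟩ := hx
    have : δB (a * (f * g - g * f) * b) = δB a * (f * g - g * f) * b + a * (δB f * g - g * δB f) * b
        + a * (f * δB g - δB g * f) * b + a * (f * g - g * f) * δB b := by
      rw [hleib, hleib, map_sub, hleib, hleib]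
      exact ring_id8 _ _ _ _ _ _ _ _
    rw [this]
    refine add_mem (add_mem (add_mem ?_ ?_) ?_) ?_ <;>
    exact Ideal.subset_span ⟨_, _, _, _, rfl⟩
  | zero => simp
  | add x y _ _ hx hy => rw [map_add]; exact add_mem hx hy
  | smul r x hx' hx =>
    rw [smul_eq_mul, hleib]
    exact add_mem (Ideal.mul_mem_left _ _ hx') (Ideal.mul_mem_left _ _ hx)

include hleib hδx hu hv in
theorem Phi_delta (w : FreeMetab K n) : ∀ l,
    Phi K n l (δB w) 0 0 = δ' (Phi K n l w 0 0) ∧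
    Phi K n l (δB w) 1 1 = δ' (Phi K n l w 1 1) ∧
    Phi K n l (δB w) 0 1 = δ' (Phi K n l w 0 1) + ∑ j, β l j • Phi K n j w 0 1 := by
  induction w using F_induct with
  | halg r =>
    intro l
    have : δB (algebraMap K _ r) = 0 := by
      rw [Algebra.algebraMap_eq_smul_one, map_smul, delta_one δB hleib, smul_zero]
    rw [this]
    simp [AlgHom.commutes, Matrix.algebraMap_matrix_apply]
  | hx i =>
    intro l
    rw [hδx]
    simp only [map_sum, map_smul, Matrix.sum_apply, Matrix.smul_apply, Phi_x]
    refine ⟨?_, ?_, ?_⟩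
    · simp [hu]
    · simp [hu, hv, Finset.sum_add_distrib]
    · simp
      split_ifs <;> simp
  | hmul a b ha hb =>
    intro l
    obtain ⟨a0, a1, a2⟩ := ha l
    obtain ⟨b0, b1, b2⟩ := hb l
    rw [hleib]
    simp only [map_add, Matrix.add_apply, Phi_00, Phi_11, Phi_01, a0, a1, a2, b0, b1, b2, Derivation.leibniz, smul_eq_mul]
    refine ⟨by ring, by ring, ?_⟩
    have : ∀ j, β l j • (Phi K n j a 0 0 * Phi K n j b 0 1 + Phi K n j a 0 1 * Phi K n j b 1 1) =
       Phi K n l a 0 0 * (β l j • Phi K n j b 0 1) + (β l j • Phi K n j a 0 1) * Phi K n l b 1 1 := by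
      intro j
      rw [(Phi_indep j l a).1, (Phi_indep j l b).2, smul_add, mul_smul_comm, smul_mul_assoc]
    simp only [this, Finset.sum_add_distrib, ← Finset.mul_sum, ← Finset.sum_mul]
    ring
  | hadd a b ha hb =>
    intro l
    obtain ⟨a0, a1, a2⟩ := ha l
    obtain ⟨b0, b1, b2⟩ := hb l
    simp only [map_add, Matrix.add_apply, a0, a1, a2, b0, b1, b2, smul_add, Finset.sum_add_distrib]
    refine ⟨trivial, trivial, ?_⟩
    abel

include hleib hδx hu hv in
theorem phi_delta (w z : comI K n) (hz : (z : FreeMetab K n) = δB w) (l : Fin n) :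
    phi K n l z = δ' (phi K n l w) + ∑ j, β l j • phi K n j w := by
  simp only [phi_apply, hz]
  exact (Phi_delta β δB hleib hδx δ' hu hv w l).2.2

include hu hv in
theorem pderiv_delta (k : Fin n) (q : PolyUV K n) :
    MvPolynomial.pderiv (Sum.inr k) (δ' q) = δ' (MvPolynomial.pderiv (Sum.inr k) q)
      + ∑ j, β k j • MvPolynomial.pderiv (Sum.inr j) q := by
  classical
  have h : ⁅(MvPolynomial.pderiv (Sum.inr k) : Derivation K (PolyUV K n) (PolyUV K n)), δ'⁆ =
      ∑ j, β k j • (MvPolynomial.pderiv (Sum.inr j) : Derivation K (PolyUV K n) (PolyUV K n)) := by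
    apply MvPolynomial.derivation_ext
    rintro (i | i)
    · rw [Derivation.commutator_apply, der_sum_apply]
      have := hu i
      unfold uP at this
      rw [this]
      simp [MvPolynomial.pderiv_X, Pi.single_apply]
    · rw [Derivation.commutator_apply, der_sum_apply]
      have := hv i
      unfold vP at this
      rw [this]
      simp [MvPolynomial.pderiv_X, Pi.single_apply, apply_ite]
  have h2 := DFunLike.congr_fun h q
  rw [Derivation.commutator_apply, der_sum_apply, sub_eq_iff_eq_add'] at h2
  simpa using h2

include hu hv in
theorem Eul_delta (J : Finset (Fin n)) (hβ : ∀ i j, β i j ≠ 0 → (i ∈ J ↔ j ∈ J)) (q : PolyUV K n) :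
    δ' (Eul K J q) = Eul K J (δ' q) := by
  have h : ⁅Eul K J, δ'⁆ = 0 := by
    apply MvPolynomial.derivation_ext
    rintro (i | i)
    · change ⁅Eul K J, δ'⁆ (uP K n i) = 0
      rw [Derivation.commutator_apply, hu, Eul_u]
      simp [Eul_u]
    · change ⁅Eul K J, δ'⁆ (vP K n i) = 0
      rw [Derivation.commutator_apply, hv, Eul_v, map_sum, sub_eq_zero]
      simp only [Derivation.map_smul, Eul_v]
      have : ∀ x, β x i • (if x ∈ J then vP K n x else 0) = if i ∈ J then β x i • vP K n x else 0 := by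
        intro x
        by_cases h : β x i = 0
        · simp [h]
        · simp [hβ _ _ h]
      simp only [this]
      split_ifs with h
      · rw [hv]
      · simp
  have h2 := DFunLike.congr_fun h q
  rw [Derivation.commutator_apply, Derivation.zero_apply, sub_eq_zero] at h2
  exact h2.symm
end delta
end Aux3

section Aux4

variable {K : Type*} [Field K] {d : ℕ}

/-- small indices -/
def Jset (d : ℕ) : Finset (Fin (d + 1)) := Finset.univ.map Fin.castSuccEmb

theorem castSucc_mem_J (i : Fin d) : i.castSucc ∈ Jset d := by simp [Jset]
theorem last_notMem_J : Fin.last d ∉ Jset d := by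
  simp only [Jset, Finset.mem_map, Finset.mem_univ, true_and, not_exists]
  intro x; exact (Fin.castSucc_lt_last x).ne

theorem sum_J {V : Type*} [AddCommMonoid V] (g : Fin (d + 1) → V) :
    ∑ k ∈ Jset d, g k = ∑ k : Fin d, g k.castSucc := by simp [Jset]

variable (K d) in
/-- The map `π` with values in the commutator ideal. -/
def ppi : PolyUV K (d + 1) →ₗ[K] comI K (d + 1) :=
  ∑ k : Fin d, (rhoAt (cc K (d + 1) (Fin.last d) k.castSucc)) ∘ₗ
    (MvPolynomial.pderiv (R := K) (Sum.inr k.castSucc : Fin (d + 1) ⊕ Fin (d + 1))).toLinearMap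

theorem ppi_apply (q : PolyUV K (d + 1)) : ppi K d q =
    ∑ k : Fin d, rho K (d + 1) (MvPolynomial.pderiv (Sum.inr k.castSucc) q) (cc K (d + 1) (Fin.last d) k.castSucc) := by
  simp [ppi, LinearMap.sum_apply, rhoAt]

theorem piMapF_eq [CharZero K] (q : PolyUV K (d + 1)) : piMapF K d q = (ppi K d q : FreeMetab K (d + 1)) := by
  conv_rhs => rw [q.as_sum]
  unfold piMapF
  rw [map_sum, AddSubmonoidClass.coe_finsetSum]
  refine Finset.sum_congr rfl fun m _ => ?_
  rw [ppi_apply, AddSubmonoidClass.coe_finsetSum, Finset.smul_sum]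
  refine Finset.sum_congr rfl fun k _ => ?_
  rw [MvPolynomial.pderiv_monomial]
  have h2 : ∀ (m : (Fin (d+1) ⊕ Fin (d+1)) →₀ ℕ) (a : K), MvPolynomial.monomial m a = a • MvPolynomial.monomial m (1 : K) := by
    intro m a; simp [MvPolynomial.smul_monomial]
  rw [h2, map_smul, LinearMap.smul_apply, Submodule.coe_smul, rho_monomial, mul_smul, Nat.cast_smul_eq_nsmul]
  rfl

theorem ppi_mul (p q : PolyUV K (d + 1)) :
    ppi K d (p * q) = rho K _ p (ppi K d q) + rho K _ q (ppi K d p) := by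
  simp only [ppi_apply, map_sum, ← Finset.sum_add_distrib]
  refine Finset.sum_congr rfl fun k _ => ?_
  rw [MvPolynomial.pderiv_mul, mul_comm _ q, map_add, map_mul, map_mul, LinearMap.add_apply]
  exact add_comm _ _

theorem phi_ppi_last (q : PolyUV K (d + 1)) :
    phi K _ (Fin.last d) (ppi K d q) = Eul K (Jset d) q := by
  have hne : ∀ k : Fin d, Fin.last d ≠ k.castSucc := fun k => (Fin.castSucc_lt_last k).ne'
  rw [ppi_apply, map_sum, Eul_apply, sum_J]
  simp [phi_rho, phi_cc, hne, mul_comm]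

theorem phi_ppi_castSucc (q : PolyUV K (d + 1)) (i : Fin d) :
    phi K _ i.castSucc (ppi K d q) = - (vP K _ (Fin.last d) * MvPolynomial.pderiv (Sum.inr i.castSucc) q) := by
  have hne : ∀ k : Fin d, k.castSucc ≠ Fin.last d := fun k => (Fin.castSucc_lt_last k).ne
  rw [ppi_apply, map_sum]
  simp [phi_rho, phi_cc, hne, mul_comm]

theorem Eul_Ls_phi_last [CharZero K] (w : comI K (d + 1)) :
    Eul K (Jset d) (Ls K (Jset d) 0 (phi K _ (Fin.last d) w)) = phi K _ (Fin.last d) w := by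
  refine comI_ext ((Eul K (Jset d)).toLinearMap ∘ₗ (Ls K (Jset d) 0) ∘ₗ phi K _ (Fin.last d)) (phi K _ (Fin.last d)) ?_ w
  intro p a b
  have hne : ∀ k : Fin d, Fin.last d ≠ k.castSucc := fun k => (Fin.castSucc_lt_last k).ne'
  simp only [LinearMap.comp_apply, phi_rho, phi_cc, Derivation.coeFn_coe]
  have hs : ∀ i : Fin d, Eul K (Jset d) (Ls K (Jset d) 0 (p * vP K _ i.castSucc)) = p * vP K _ i.castSucc := by
    intro i
    rw [mul_comm, Eul_Ls0 _ (castSucc_mem_J i)]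
  induction a using Fin.lastCases with
  | last =>
    induction b using Fin.lastCases with
    | last => simp
    | cast j => simp [hne, hs]
  | cast i =>
    induction b using Fin.lastCases with
    | last => simp [hne, hs]
    | cast j => simp [hne]

/-- extension of the matrix by zero -/
def bet (α : Matrix (Fin d) (Fin d) K) : Matrix (Fin (d + 1)) (Fin (d + 1)) K := fun i j =>
  Fin.lastCases (motive := fun _ => K) 0 (fun i' => Fin.lastCases (motive := fun _ => K) 0 (fun j' => α i' j') j) i

theorem bet_cc (α : Matrix (Fin d) (Fin d) K) (i j : Fin d) : bet α i.castSucc j.castSucc = α i j := by simp [bet]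
theorem bet_l (α : Matrix (Fin d) (Fin d) K) (j) : bet α (Fin.last d) j = 0 := by simp [bet]
theorem bet_r (α : Matrix (Fin d) (Fin d) K) (i) : bet α i (Fin.last d) = 0 := by
  induction i using Fin.lastCases <;> simp [bet]

theorem bet_J (α : Matrix (Fin d) (Fin d) K) (i j) (h : bet α i j ≠ 0) : i ∈ Jset d ↔ j ∈ Jset d := by
  induction i using Fin.lastCases with
  | last => exact absurd (bet_l α j) h
  | cast i =>
    induction j using Fin.lastCases with
    | last => exact absurd (bet_r α _) h
    | cast j => simp [castSucc_mem_J]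

theorem bet_hyp {V : Type*} [AddCommMonoid V] [Module K V] (α : Matrix (Fin d) (Fin d) K) (x y : Fin (d + 1) → V)
    (h : ∀ j : Fin d, y j.castSucc = ∑ i : Fin d, α i j • x i.castSucc) (h0 : y (Fin.last d) = 0) (j) :
    y j = ∑ i, bet α i j • x i := by
  rw [Fin.sum_univ_castSucc, bet_l, zero_smul, add_zero]
  induction j using Fin.lastCases with
  | last => simp [bet_r, h0]
  | cast j => simp [bet_cc, h]

section comps

theorem smallU_mem (i : Fin d) : (MvPolynomial.X (Sum.inl i.castSucc) : PolyUV K (d + 1)) ∈ MvPolynomial.supported K (smallSet d) :=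
  MvPolynomial.X_mem_supported.2 ⟨i, Or.inl rfl⟩
theorem smallV_mem (i : Fin d) : (MvPolynomial.X (Sum.inr i.castSucc) : PolyUV K (d + 1)) ∈ MvPolynomial.supported K (smallSet d) :=
  MvPolynomial.X_mem_supported.2 ⟨i, Or.inr rfl⟩

variable (K d) in
/-- Images of the variables under separation of the last variables. -/
def thVar : Fin (d + 1) ⊕ Fin (d + 1) → MvPolynomial (Fin 2) (MvPolynomial.supported K (smallSet d))
  | Sum.inl j => Fin.lastCases (motive := fun _ => MvPolynomial (Fin 2) (MvPolynomial.supported K (smallSet d)))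
      (MvPolynomial.X 0) (fun i => MvPolynomial.C ⟨_, smallU_mem i⟩) j
  | Sum.inr j => Fin.lastCases (motive := fun _ => MvPolynomial (Fin 2) (MvPolynomial.supported K (smallSet d)))
      (MvPolynomial.X 1) (fun i => MvPolynomial.C ⟨_, smallV_mem i⟩) j

variable (K d) in
/-- Separation of the last variables. -/
def Theta : PolyUV K (d + 1) →ₐ[K] MvPolynomial (Fin 2) (MvPolynomial.supported K (smallSet d)) :=
  MvPolynomial.aeval (thVar K d)

variable (K d) in
/-- Component. -/
def comp (t : Fin 2 →₀ ℕ) : PolyUV K (d + 1) →ₗ[K] PolyUV K (d + 1) where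
  toFun q := ((Theta K d q).coeff t : MvPolynomial.supported K (smallSet d))
  map_add' p q := by simp
  map_smul' a q := by
    rw [map_smul, MvPolynomial.coeff_smul]; rfl

theorem comp_mem (t) (q : PolyUV K (d + 1)) : comp K d t q ∈ MvPolynomial.supported K (smallSet d) := Subtype.prop _

theorem Theta_U (i : Fin d) : Theta K d (uP K _ i.castSucc) = MvPolynomial.C ⟨_, smallU_mem i⟩ := by
  simp [Theta, thVar, uP]
theorem Theta_V (i : Fin d) : Theta K d (vP K _ i.castSucc) = MvPolynomial.C ⟨_, smallV_mem i⟩ := by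
  simp [Theta, thVar, vP]
theorem Theta_ul : Theta K d (uP K _ (Fin.last d)) = MvPolynomial.X 0 := by
  simp [Theta, thVar, uP]
theorem Theta_vl : Theta K d (vP K _ (Fin.last d)) = MvPolynomial.X 1 := by
  simp [Theta, thVar, vP]

theorem comp_mul_U (t) (q : PolyUV K (d + 1)) (i : Fin d) :
    comp K d t (q * uP K _ i.castSucc) = comp K d t q * uP K _ i.castSucc := by
  change (((Theta K d (q * uP K _ i.castSucc)).coeff t : MvPolynomial.supported K (smallSet d)) : PolyUV K (d + 1)) = _
  rw [map_mul, Theta_U, mul_comm, MvPolynomial.coeff_C_mul]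
  exact mul_comm _ _
theorem comp_mul_V (t) (q : PolyUV K (d + 1)) (i : Fin d) :
    comp K d t (q * vP K _ i.castSucc) = comp K d t q * vP K _ i.castSucc := by
  change (((Theta K d (q * vP K _ i.castSucc)).coeff t : MvPolynomial.supported K (smallSet d)) : PolyUV K (d + 1)) = _
  rw [map_mul, Theta_V, mul_comm, MvPolynomial.coeff_C_mul]
  exact mul_comm _ _
theorem comp_mul_ul (t) (q : PolyUV K (d + 1)) :
    comp K d t (q * uP K _ (Fin.last d)) = if 0 ∈ t.support then comp K d (t - Finsupp.single 0 1) q else 0 := by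
  change (((Theta K d (q * uP K _ (Fin.last d))).coeff t : MvPolynomial.supported K (smallSet d)) : PolyUV K (d + 1)) = _
  rw [map_mul, Theta_ul, MvPolynomial.coeff_mul_X']; split_ifs <;> rfl
theorem comp_mul_vl (t) (q : PolyUV K (d + 1)) :
    comp K d t (q * vP K _ (Fin.last d)) = if 1 ∈ t.support then comp K d (t - Finsupp.single 1 1) q else 0 := by
  change (((Theta K d (q * vP K _ (Fin.last d))).coeff t : MvPolynomial.supported K (smallSet d)) : PolyUV K (d + 1)) = _
  rw [map_mul, Theta_vl, MvPolynomial.coeff_mul_X']; split_ifs <;> rfl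

theorem comp_C (t) (a : K) : ∃ b : K, comp K d t (MvPolynomial.C a) = MvPolynomial.C b := by
  classical
  have : comp K d t (MvPolynomial.C a) = (((Theta K d (MvPolynomial.C a)).coeff t : MvPolynomial.supported K (smallSet d)) : PolyUV K (d + 1)) := rfl
  rw [this, ← MvPolynomial.algebraMap_eq, AlgHom.commutes, MvPolynomial.algebraMap_apply, MvPolynomial.coeff_C]
  split_ifs
  · exact ⟨a, rfl⟩
  · exact ⟨0, by simp⟩

variable (K d) in
/-- monomials in the last variables -/
def monL (t : Fin 2 →₀ ℕ) : PolyUV K (d + 1) := uP K _ (Fin.last d) ^ t 0 * vP K _ (Fin.last d) ^ t 1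

theorem recon (q : PolyUV K (d + 1)) (S : Finset (Fin 2 →₀ ℕ)) (hS : (Theta K d q).support ⊆ S) :
    q = ∑ t ∈ S, monL K d t * comp K d t q := by
  have h : ((MvPolynomial.aeval (R := MvPolynomial.supported K (smallSet d))
      ![uP K _ (Fin.last d), vP K _ (Fin.last d)]).restrictScalars K).comp (Theta K d) = AlgHom.id K _ := by
    apply MvPolynomial.algHom_ext
    rintro (j | j)
    · induction j using Fin.lastCases with
      | last => simp [Theta, thVar, uP]
      | cast i => simp [Theta, thVar]
    · induction j using Fin.lastCases with
      | last => simp [Theta, thVar, vP]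
      | cast i => simp [Theta, thVar]
  have h2 := DFunLike.congr_fun h q
  simp only [AlgHom.comp_apply, AlgHom.restrictScalars_apply, AlgHom.id_apply] at h2
  rw [MvPolynomial.aeval_def, MvPolynomial.eval₂_eq'] at h2
  conv_lhs => rw [← h2]
  rw [Finset.sum_subset hS]
  · refine Finset.sum_congr rfl fun t _ => ?_
    rw [mul_comm, Fin.prod_univ_two]
    rfl
  · intro t _ ht
    rw [MvPolynomial.notMem_support_iff.1 ht]; simp

theorem comp_delta (α : Matrix (Fin d) (Fin d) K)
    (δ' : Derivation K (PolyUV K (d + 1)) (PolyUV K (d + 1)))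
    (hu : ∀ j : Fin d, δ' (uP K (d + 1) j.castSucc)
      = ∑ i : Fin d, α i j • uP K (d + 1) i.castSucc)
    (hulast : δ' (uP K (d + 1) (Fin.last d)) = 0)
    (hv : ∀ j : Fin d, δ' (vP K (d + 1) j.castSucc)
      = ∑ i : Fin d, α i j • vP K (d + 1) i.castSucc)
    (hvlast : δ' (vP K (d + 1) (Fin.last d)) = 0) (q : PolyUV K (d + 1)) :
    ∀ t, comp K d t (δ' q) = δ' (comp K d t q) := by
  induction q using MvPolynomial.induction_on with
  | C a =>
    intro t
    obtain ⟨b, hb⟩ := comp_C (d := d) t a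
    rw [hb, MvPolynomial.derivation_C, MvPolynomial.derivation_C, map_zero]
  | add p q hp hq => intro t; simp only [map_add, hp, hq]
  | mul_X q s hq =>
    intro t
    rcases s with j | j
    · change comp K d t (δ' (q * uP K _ j)) = δ' (comp K d t (q * uP K _ j))
      induction j using Fin.lastCases with
      | last =>
        rw [Derivation.leibniz, hulast, smul_zero, zero_add, smul_eq_mul, mul_comm, comp_mul_ul, comp_mul_ul]
        split_ifs
        · rw [hq]
        · simp
      | cast i =>
        rw [Derivation.leibniz, smul_eq_mul, smul_eq_mul, mul_comm (uP K _ _), map_add, comp_mul_U, comp_mul_U,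
          Derivation.leibniz, hu, smul_eq_mul, smul_eq_mul, hq, Finset.mul_sum, map_sum, Finset.mul_sum, mul_comm (uP K _ _)]
        simp only [mul_smul_comm, map_smul, comp_mul_U]
    · change comp K d t (δ' (q * vP K _ j)) = δ' (comp K d t (q * vP K _ j))
      induction j using Fin.lastCases with
      | last =>
        rw [Derivation.leibniz, hvlast, smul_zero, zero_add, smul_eq_mul, mul_comm, comp_mul_vl, comp_mul_vl]
        split_ifs
        · rw [hq]
        · simp
      | cast i =>
        rw [Derivation.leibniz, smul_eq_mul, smul_eq_mul, mul_comm (vP K _ _), map_add, comp_mul_V, comp_mul_V,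
          Derivation.leibniz, hv, smul_eq_mul, smul_eq_mul, hq, Finset.mul_sum, map_sum, Finset.mul_sum, mul_comm (vP K _ _)]
        simp only [mul_smul_comm, map_smul, comp_mul_V]

end comps

section small

variable [CharZero K]

theorem Ls_supported (J : Finset (Fin (d + 1))) (s : ℕ) (A : Set (Fin (d + 1) ⊕ Fin (d + 1))) {q : PolyUV K (d + 1)}
    (hq : q ∈ MvPolynomial.supported K A) : Ls K J s q ∈ MvPolynomial.supported K A := by
  classical
  rw [MvPolynomial.mem_supported] at hq ⊢
  refine subset_trans ?_ hq
  intro i hi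
  simp only [Finset.mem_coe, MvPolynomial.mem_vars_iff_mem_support] at hi ⊢
  obtain ⟨m, hm, him⟩ := hi
  refine ⟨m, ?_, him⟩
  rw [MvPolynomial.mem_support_iff] at hm ⊢
  intro h0
  apply hm
  rw [Ls, diagOp_coeff, h0, mul_zero]

theorem pderiv_supported (s : Fin (d + 1) ⊕ Fin (d + 1)) (A : Set (Fin (d + 1) ⊕ Fin (d + 1))) {q : PolyUV K (d + 1)}
    (hq : q ∈ MvPolynomial.supported K A) : MvPolynomial.pderiv s q ∈ MvPolynomial.supported K A := by
  classical
  unfold MvPolynomial.supported at hq ⊢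
  induction hq using Algebra.adjoin_induction with
  | mem x hx =>
    obtain ⟨i, hi, rfl⟩ := hx
    rw [MvPolynomial.pderiv_X, Pi.single_apply]
    split_ifs
    · exact one_mem _
    · exact zero_mem _
  | algebraMap r => rw [Derivation.map_algebraMap]; exact zero_mem _
  | add x y _ _ hx hy => rw [map_add]; exact add_mem hx hy
  | mul x y hx' hy' hx hy =>
    rw [MvPolynomial.pderiv_mul]
    exact add_mem (mul_mem hx hy') (mul_mem hx' hy)

theorem smallComm_le : smallComm K d ≤ comI K (d + 1) := by
  unfold smallComm
  rw [Submodule.span_le]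
  rintro _ ⟨a, f, g, b, -, -, -, -, rfl⟩
  exact Ideal.subset_span ⟨a, f, g, b, rfl⟩

theorem smallComm_mul {z : FreeMetab K (d + 1)} (hz : z ∈ smallComm K d) {r : FreeMetab K (d + 1)} (hr : r ∈ Fsmall K d) :
    r * z ∈ smallComm K d ∧ z * r ∈ smallComm K d := by
  unfold smallComm at hz ⊢
  induction hz using Submodule.span_induction with
  | mem x hx =>
    obtain ⟨a, f, g, b, ha, hf, hg, hb, rfl⟩ := hx
    exact ⟨Submodule.subset_span ⟨r * a, f, g, b, mul_mem hr ha, hf, hg, hb, by simp only [mul_assoc]⟩,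
      Submodule.subset_span ⟨a, f, g, b * r, ha, hf, hg, mul_mem hb hr, by simp only [mul_assoc]⟩⟩
  | zero => simp
  | add x y _ _ hx hy => rw [mul_add, add_mul]; exact ⟨add_mem hx.1 hy.1, add_mem hx.2 hy.2⟩
  | smul c x _ hx =>
    rw [mul_smul_comm, smul_mul_assoc]; exact ⟨Submodule.smul_mem _ _ hx.1, Submodule.smul_mem _ _ hx.2⟩

theorem xg_small (i : Fin d) : xg K (d + 1) i.castSucc ∈ Fsmall K d := Algebra.subset_adjoin ⟨i, rfl⟩

theorem rho_small {p : PolyUV K (d + 1)} (hp : p ∈ MvPolynomial.supported K (smallSet d)) :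
    ∀ z : comI K (d + 1), (z : FreeMetab K (d + 1)) ∈ smallComm K d → (rho K _ p z : FreeMetab K (d + 1)) ∈ smallComm K d := by
  unfold MvPolynomial.supported at hp
  induction hp using Algebra.adjoin_induction with
  | mem x hx =>
    obtain ⟨s, ⟨i, rfl | rfl⟩, rfl⟩ := hx
    · intro z hz
      rw [rho_inl]
      exact (smallComm_mul hz (xg_small i)).1
    · intro z hz
      rw [rho_inr]
      exact sub_mem (smallComm_mul hz (xg_small i)).2 (smallComm_mul hz (xg_small i)).1
  | algebraMap r =>
    intro z hz
    rw [AlgHom.commutes, Module.algebraMap_end_apply, Submodule.coe_smul]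
    exact Submodule.smul_mem _ _ hz
  | add x y _ _ hx hy =>
    intro z hz
    rw [map_add, LinearMap.add_apply, Submodule.coe_add]; exact add_mem (hx z hz) (hy z hz)
  | mul x y _ _ hx hy =>
    intro z hz
    rw [map_mul, Module.End.mul_apply]; exact hx _ (hy z hz)

theorem cc_small (i j : Fin d) : (cc K (d + 1) i.castSucc j.castSucc : FreeMetab K (d + 1)) ∈ smallComm K d :=
  Submodule.subset_span ⟨1, _, _, 1, one_mem _, xg_small i, xg_small j, one_mem _, by
    rw [one_mul, mul_one]; rfl⟩

end small

end Aux4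

section Aux5

variable {K : Type*} [Field K] [CharZero K] {d : ℕ}

/-- The module generated by a family over the constants. -/
def Gen (δ' : Derivation K (PolyUV K (d + 1)) (PolyUV K (d + 1))) {ι : Type} (g : ι → comI K (d + 1)) :
    Submodule K (comI K (d + 1)) :=
  Submodule.span K {z | ∃ (h : PolyUV K (d + 1)) (s : ι), δ' h = 0 ∧ z = rho K (d + 1) h (g s)}

section gen
variable (δ' : Derivation K (PolyUV K (d + 1)) (PolyUV K (d + 1))) {ι : Type} (g : ι → comI K (d + 1))

theorem const_mul {p q : PolyUV K (d + 1)} (hp : δ' p = 0) (hq : δ' q = 0) : δ' (p * q) = 0 := by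
  rw [Derivation.leibniz, hp, hq, smul_zero, smul_zero, add_zero]

theorem Gen_rho {p : PolyUV K (d + 1)} (hp : δ' p = 0) {z : comI K (d + 1)} (hz : z ∈ Gen δ' g) :
    rho K (d + 1) p z ∈ Gen δ' g := by
  unfold Gen at hz ⊢
  induction hz using Submodule.span_induction with
  | mem x hx =>
    obtain ⟨h, s, hh, rfl⟩ := hx
    refine Submodule.subset_span ⟨p * h, s, const_mul δ' hp hh, ?_⟩
    rw [map_mul, Module.End.mul_apply]
  | zero => rw [map_zero]; exact zero_mem _
  | add x y _ _ hx hy => rw [map_add]; exact add_mem hx hy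
  | smul a x _ hx => rw [map_smul]; exact Submodule.smul_mem _ _ hx

theorem Gen_exists {z : comI K (d + 1)} (hz : z ∈ Gen δ' g) :
    ∃ (N : ℕ) (h : Fin N → PolyUV K (d + 1)) (sel : Fin N → ι),
      (∀ r, δ' (h r) = 0) ∧ z = ∑ r, rho K (d + 1) (h r) (g (sel r)) := by
  unfold Gen at hz
  induction hz using Submodule.span_induction with
  | mem x hx =>
    obtain ⟨h, s, hh, rfl⟩ := hx
    exact ⟨1, fun _ => h, fun _ => s, fun _ => hh, by simp⟩
  | zero => exact ⟨0, Fin.elim0, Fin.elim0, fun r => r.elim0, by simp⟩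
  | add x y _ _ hx hy =>
    obtain ⟨N, h, s, hh, rfl⟩ := hx
    obtain ⟨N', h', s', hh', rfl⟩ := hy
    refine ⟨N + N', Fin.append h h', Fin.append s s', ?_, ?_⟩
    · intro r
      refine Fin.addCases (fun i => ?_) (fun i => ?_) r
      · rw [Fin.append_left]; exact hh i
      · rw [Fin.append_right]; exact hh' i
    · rw [Fin.sum_univ_add]
      simp only [Fin.append_left, Fin.append_right]
  | smul a x _ hx =>
    obtain ⟨N, h, s, hh, rfl⟩ := hx
    refine ⟨N, fun r => a • h r, s, fun r => by rw [Derivation.map_smul, hh, smul_zero], ?_⟩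
    rw [Finset.smul_sum]
    refine Finset.sum_congr rfl fun r _ => ?_
    rw [map_smul, LinearMap.smul_apply]

end gen

section claims
variable (α : Matrix (Fin d) (Fin d) K)
    (δ' : Derivation K (PolyUV K (d + 1)) (PolyUV K (d + 1)))
    (hu : ∀ j : Fin d, δ' (uP K (d + 1) j.castSucc)
      = ∑ i : Fin d, α i j • uP K (d + 1) i.castSucc)
    (hulast : δ' (uP K (d + 1) (Fin.last d)) = 0)
    (hv : ∀ j : Fin d, δ' (vP K (d + 1) j.castSucc)
      = ∑ i : Fin d, α i j • vP K (d + 1) i.castSucc)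
    (hvlast : δ' (vP K (d + 1) (Fin.last d)) = 0)

theorem const_pow {p : PolyUV K (d + 1)} (hp : δ' p = 0) (n : ℕ) : δ' (p ^ n) = 0 := by
  rw [Derivation.leibniz_pow, hp, smul_zero, smul_zero]

include hulast hvlast in
theorem monL_const (t) : δ' (monL K d t) = 0 :=
  const_mul δ' (const_pow δ' hulast _) (const_pow δ' hvlast _)

theorem ppi_monL (t) : ppi K d (monL K d t) = 0 := by
  rw [ppi_apply]
  refine Finset.sum_eq_zero fun k _ => ?_
  have hne : (Fin.last d) ≠ k.castSucc := (Fin.castSucc_lt_last k).ne'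
  have h1 : MvPolynomial.pderiv (Sum.inr k.castSucc) (uP K _ (Fin.last d)) = 0 :=
    MvPolynomial.pderiv_X_of_ne (by simp)
  have h2 : MvPolynomial.pderiv (Sum.inr k.castSucc) (vP K _ (Fin.last d)) = 0 :=
    MvPolynomial.pderiv_X_of_ne (by simpa using hne)
  rw [monL, const_mul _ (const_pow _ h1 _) (const_pow _ h2 _), map_zero, LinearMap.zero_apply]

theorem ppi_e {e : PolyUV K (d + 1)} (he : e ∈ MvPolynomial.supported K (smallUSet d)) : ppi K d e = 0 := by
  rw [ppi_apply]
  refine Finset.sum_eq_zero fun k _ => ?_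
  rw [MvPolynomial.pderiv_eq_zero_of_notMem_vars, map_zero, LinearMap.zero_apply]
  intro h
  obtain ⟨i, hi⟩ := MvPolynomial.mem_supported.1 he h
  exact absurd hi (by simp)

/-- `π q` lies in the module for `q` in the subalgebra. -/
theorem ppi_adjoin {ι : Type} (g : ι → comI K (d + 1)) {k L : ℕ} (e : Fin k → PolyUV K (d + 1)) (f : Fin L → PolyUV K (d + 1))
    (he : ∀ t, e t ∈ MvPolynomial.supported K (smallUSet d) ∧ δ' (e t) = 0)
    (hf : ∀ t, δ' (f t) = 0) (hfg : ∀ j, ppi K d (f j) ∈ Gen δ' g) {q : PolyUV K (d + 1)}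
    (hq : q ∈ Algebra.adjoin K (Set.range e ∪ Set.range f)) : δ' q = 0 ∧ ppi K d q ∈ Gen δ' g := by
  induction hq using Algebra.adjoin_induction with
  | mem x hx =>
    rcases hx with ⟨i, rfl⟩ | ⟨i, rfl⟩
    · refine ⟨(he i).2, ?_⟩
      rw [ppi_e (he i).1]; exact zero_mem _
    · exact ⟨hf i, hfg i⟩
  | algebraMap r =>
    refine ⟨Derivation.map_algebraMap _ _, ?_⟩
    rw [ppi_e (Subalgebra.algebraMap_mem _ r)]; exact zero_mem _
  | add x y _ _ hx hy => rw [map_add, map_add, hx.1, hy.1, add_zero]; exact ⟨rfl, add_mem hx.2 hy.2⟩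
  | mul x y _ _ hx hy =>
    refine ⟨const_mul δ' hx.1 hy.1, ?_⟩
    rw [ppi_mul]
    exact add_mem (Gen_rho δ' g hx.1 hy.2) (Gen_rho δ' g hy.1 hx.2)

include hu hulast hv hvlast in
theorem ppi_gen {ι : Type} (g : ι → comI K (d + 1)) {k L : ℕ} (e : Fin k → PolyUV K (d + 1)) (f : Fin L → PolyUV K (d + 1))
    (he : ∀ t, e t ∈ MvPolynomial.supported K (smallUSet d) ∧ δ' (e t) = 0)
    (hf : ∀ t, δ' (f t) = 0) (hfg : ∀ j, ppi K d (f j) ∈ Gen δ' g)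
    (hef : ∀ q ∈ MvPolynomial.supported K (smallSet d), δ' q = 0 →
      q ∈ Algebra.adjoin K (Set.range e ∪ Set.range f)) {q : PolyUV K (d + 1)}
    (hq : δ' q = 0) : ppi K d q ∈ Gen δ' g := by
  rw [recon q _ subset_rfl, map_sum]
  refine sum_mem fun t _ => ?_
  rw [ppi_mul, ppi_monL, map_zero, add_zero]
  refine Gen_rho δ' g (monL_const δ' hulast hvlast t) ?_
  refine (ppi_adjoin δ' g e f he hf hfg (hef _ (comp_mem t q) ?_)).2
  rw [← comp_delta α δ' hu hulast hv hvlast, hq, map_zero]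

include hu hulast hv hvlast in
theorem ppi_const {q : PolyUV K (d + 1)} (hq : δ' q = 0) (l) :
    δ' (phi K _ l (ppi K d q)) + ∑ j, bet α l j • phi K _ j (ppi K d q) = 0 := by
  have hU := bet_hyp α (uP K (d + 1)) (fun j => δ' (uP K (d + 1) j)) hu hulast
  have hV := bet_hyp α (vP K (d + 1)) (fun j => δ' (vP K (d + 1) j)) hv hvlast
  induction l using Fin.lastCases with
  | last =>
    rw [phi_ppi_last, Eul_delta (bet α) δ' hU hV _ (bet_J α), hq, map_zero]
    simp [bet_l]
  | cast i =>
    have h := pderiv_delta (bet α) δ' hU hV i.castSucc q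
    rw [hq, map_zero, Fin.sum_univ_castSucc, bet_r, zero_smul, add_zero] at h
    rw [Fin.sum_univ_castSucc, bet_r, zero_smul, add_zero]
    simp only [phi_ppi_castSucc, map_neg, Derivation.leibniz, hvlast, smul_zero, add_zero, smul_neg, smul_eq_mul,
      Finset.sum_neg_distrib, ← mul_smul_comm, ← Finset.mul_sum]
    rw [mul_zero, add_zero, ← neg_add, ← mul_add, ← h, mul_zero, neg_zero]

/-- The small components of an element. -/
def wt (w : comI K (d + 1)) (t : Fin 2 →₀ ℕ) : comI K (d + 1) :=
  ∑ i, ∑ k ∈ Jset d, rho K (d + 1) (MvPolynomial.pderiv (Sum.inr k)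
    (Ls K (Jset d) 1 (comp K d t (phi K _ i w)))) (cc K (d + 1) i k)

theorem phi_wt {w : comI K (d + 1)} (h0 : phi K _ (Fin.last d) w = 0) (t) (j) :
    phi K _ j (wt w t) = comp K d t (phi K _ j w) := by
  unfold wt
  rw [phi_psi (Jset d) (fun i => Ls K (Jset d) 1 (comp K d t (phi K _ i w)))]
  · induction j using Fin.lastCases with
    | last => rw [if_neg last_notMem_J, h0, map_zero]
    | cast j =>
      rw [if_pos (castSucc_mem_J j)]
      have := Eul_Ls (Jset d) 0 (comp K d t (phi K _ j.castSucc w))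
      simpa using this
  · intro i hi
    induction i using Fin.lastCases with
    | last => rw [h0, map_zero, map_zero]
    | cast j => exact absurd (castSucc_mem_J j) hi
  · have hk := congrArg (fun p => Ls K (Jset d) 0 (comp K d t p)) (phi_koszul w)
    simp only [Fin.sum_univ_castSucc, h0, mul_zero, add_zero, map_sum, map_zero] at hk ⊢
    rw [← hk]
    refine Finset.sum_congr rfl fun i _ => ?_
    rw [mul_comm _ (phi K _ _ w), comp_mul_V, mul_comm (comp K d t _), Ls_v _ _ (castSucc_mem_J i)]

theorem wt_small {w : comI K (d + 1)} (h0 : phi K _ (Fin.last d) w = 0) (t) :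
    (wt w t : FreeMetab K (d + 1)) ∈ smallComm K d := by
  unfold wt
  rw [Fin.sum_univ_castSucc, h0]
  simp only [map_zero, LinearMap.zero_apply, Finset.sum_const_zero, add_zero, sum_J]
  rw [AddSubmonoidClass.coe_finsetSum]
  refine sum_mem fun i _ => ?_
  rw [AddSubmonoidClass.coe_finsetSum]
  refine sum_mem fun k _ => ?_
  exact rho_small (pderiv_supported _ _ (Ls_supported _ _ _ (comp_mem _ _))) _ (cc_small i k)

theorem wt_sum {w : comI K (d + 1)} (h0 : phi K _ (Fin.last d) w = 0) :
    ∃ S : Finset (Fin 2 →₀ ℕ), w = ∑ t ∈ S, rho K (d + 1) (monL K d t) (wt w t) := by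
  classical
  refine ⟨Finset.univ.biUnion fun i => (Theta K d (phi K _ i w)).support, phi_inj fun i => ?_⟩
  rw [map_sum]
  simp only [phi_rho, phi_wt h0]
  exact recon _ _ (Finset.subset_biUnion_of_mem (fun i => (Theta K d (phi K _ i w)).support) (Finset.mem_univ i))

variable (δB : FreeMetab K (d + 1) →ₗ[K] FreeMetab K (d + 1))
    (hleib : ∀ a b : FreeMetab K (d + 1), δB (a * b) = δB a * b + a * δB b)
    (hδx : ∀ j : Fin d, δB (xg K (d + 1) j.castSucc)
      = ∑ i : Fin d, α i j • xg K (d + 1) i.castSucc)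
    (hδlast : δB (xg K (d + 1) (Fin.last d)) = 0)

include hu hulast hv hvlast hleib hδx hδlast in
theorem wt_const {w : comI K (d + 1)} (h0 : phi K _ (Fin.last d) w = 0)
    (hw : ∀ l, δ' (phi K _ l w) + ∑ j, bet α l j • phi K _ j w = 0) (t) :
    δB (wt w t) = 0 := by
  have hU := bet_hyp α (uP K (d + 1)) (fun j => δ' (uP K (d + 1) j)) hu hulast
  have hV := bet_hyp α (vP K (d + 1)) (fun j => δ' (vP K (d + 1) j)) hv hvlast
  have hX := bet_hyp α (xg K (d + 1)) (fun j => δB (xg K (d + 1) j)) hδx hδlast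
  have hm : δB (wt w t) ∈ comI K (d + 1) := delta_mem δB hleib (wt w t).2
  have hz : (⟨δB (wt w t), hm⟩ : comI K (d + 1)) = 0 := by
    refine phi_inj fun l => ?_
    rw [phi_delta (bet α) δB hleib hX δ' hU hV (wt w t) _ rfl l, map_zero]
    simp only [phi_wt h0]
    rw [← comp_delta α δ' hu hulast hv hvlast]
    have h3 := congrArg (comp K d t) (hw l)
    rw [map_add, map_sum, map_zero] at h3
    simpa only [map_smul] using h3
  exact congrArg Subtype.val hz

include hu hulast hv hvlast hleib hδx hδlast in
theorem const_phi {w : comI K (d + 1)} (hw : δB w = 0) (l) :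
    δ' (phi K _ l w) + ∑ j, bet α l j • phi K _ j w = 0 := by
  have hU := bet_hyp α (uP K (d + 1)) (fun j => δ' (uP K (d + 1) j)) hu hulast
  have hV := bet_hyp α (vP K (d + 1)) (fun j => δ' (vP K (d + 1) j)) hv hvlast
  have hX := bet_hyp α (xg K (d + 1)) (fun j => δB (xg K (d + 1) j)) hδx hδlast
  rw [← phi_delta (bet α) δB hleib hX δ' hU hV w 0 (by rw [hw]; rfl) l, map_zero]

include hu hulast hv hvlast hleib hδx hδlast in
theorem main_decomp {w : comI K (d + 1)} (hw : δB w = 0) :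
    ∃ (Q : PolyUV K (d + 1)) (S : Finset (Fin 2 →₀ ℕ)) (ws : (Fin 2 →₀ ℕ) → comI K (d + 1)),
      δ' Q = 0 ∧ (∀ t, (ws t : FreeMetab K (d + 1)) ∈ smallComm K d ∧ δB (ws t) = 0) ∧
      w = ∑ t ∈ S, rho K (d + 1) (monL K d t) (ws t) + ppi K d Q := by
  have hU := bet_hyp α (uP K (d + 1)) (fun j => δ' (uP K (d + 1) j)) hu hulast
  have hV := bet_hyp α (vP K (d + 1)) (fun j => δ' (vP K (d + 1) j)) hv hvlast
  have hcw := const_phi α δ' hu hulast hv hvlast δB hleib hδx hδlast hw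
  set Q := Ls K (Jset d) 0 (phi K _ (Fin.last d) w) with hQdef
  have hQ : δ' Q = 0 := by
    have h1 := Ls_comm (Jset d) δ'.toLinearMap (fun q => Eul_delta (bet α) δ' hU hV _ (bet_J α) q) 0
      (phi K _ (Fin.last d) w)
    have h2 := hcw (Fin.last d)
    simp only [bet_l, zero_smul, Finset.sum_const_zero, add_zero] at h2
    have h3 : δ' Q = Ls K (Jset d) 0 (δ' (phi K _ (Fin.last d) w)) := h1
    rw [h3, h2, map_zero]
  have hcQ := ppi_const α δ' hu hulast hv hvlast hQ
  set w' : comI K (d + 1) := w + (-1 : K) • ppi K d Q with hw'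
  have h0 : phi K _ (Fin.last d) w' = 0 := by
    rw [hw', map_add, map_smul, phi_ppi_last, hQdef, Eul_Ls_phi_last, cancel_smul]
  have hcw' : ∀ l, δ' (phi K _ l w') + ∑ j, bet α l j • phi K _ j w' = 0 := by
    intro l
    have e1 : δ' (phi K _ l w') + ∑ j, bet α l j • phi K _ j w' =
        (δ' (phi K _ l w) + ∑ j, bet α l j • phi K _ j w) +
        (-1 : K) • (δ' (phi K _ l (ppi K d Q)) + ∑ j, bet α l j • phi K _ j (ppi K d Q)) := by
      have a1 : ∀ l, phi K _ l w' = phi K _ l w + (-1 : K) • phi K _ l (ppi K d Q) := by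
        intro l
        rw [hw', map_add, map_smul]
      simp only [a1, map_add, Derivation.map_smul, smul_add, Finset.sum_add_distrib, Finset.smul_sum]
      simp only [neg_smul, one_smul, smul_neg]
      abel
    rw [e1, hcw, hcQ, smul_zero, add_zero]
  obtain ⟨S, hS⟩ := wt_sum h0
  refine ⟨Q, S, wt w', hQ, fun t => ⟨wt_small h0 t,
    wt_const α δ' hu hulast hv hvlast δB hleib hδx hδlast h0 hcw' t⟩, ?_⟩
  rw [← hS, hw', add_assoc, add_comm _ (ppi K d Q), cancel_smul, add_zero]

end claims

end Aux5

/-- Assume `δ(x_{d+1}) = 0` and `δ` maps the span of `x_1,…,x_d`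
nilpotently into itself.  If `{c_1,…,c_M}` is a homogeneous generating set of the
`K[U_d,V_d]^δ`-module `(F_d')^δ` and `{e_1,…,e_k,f_1,…,f_L}` a generating set of the
algebra `K[U_d,V_d]^δ` with the `e`'s independent of the `v`'s and every monomial of the
`f`'s of positive `v`-degree, then the `K[U_{d+1},V_{d+1}]^δ`-module `(F_{d+1}')^δ` is
generated by `{c_1,…,c_M} ∪ {π(f_1),…,π(f_L)}`. -/
theorem generators_from_smaller_rank
    (hd : 1 ≤ d)
    (α : Matrix (Fin d) (Fin d) K) (hnil : IsNilpotent α) (hne : α ≠ 0)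
    (δB : FreeMetab K (d + 1) →ₗ[K] FreeMetab K (d + 1))
    (hleib : ∀ a b : FreeMetab K (d + 1), δB (a * b) = δB a * b + a * δB b)
    (hδx : ∀ j : Fin d, δB (xg K (d + 1) j.castSucc)
      = ∑ i : Fin d, α i j • xg K (d + 1) i.castSucc)
    (hδlast : δB (xg K (d + 1) (Fin.last d)) = 0)
    (δ' : Derivation K (PolyUV K (d + 1)) (PolyUV K (d + 1)))
    (hu : ∀ j : Fin d, δ' (uP K (d + 1) j.castSucc)
      = ∑ i : Fin d, α i j • uP K (d + 1) i.castSucc)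
    (hulast : δ' (uP K (d + 1) (Fin.last d)) = 0)
    (hv : ∀ j : Fin d, δ' (vP K (d + 1) j.castSucc)
      = ∑ i : Fin d, α i j • vP K (d + 1) i.castSucc)
    (hvlast : δ' (vP K (d + 1) (Fin.last d)) = 0)
    -- the generators `c_1,…,c_M` of the `K[U_d,V_d]^δ`-module `(F_d')^δ`
    (M : ℕ) (c : Fin M → FreeMetab K (d + 1))
    (hc : ∀ t, c t ∈ smallComm K d ∧ δB (c t) = 0 ∧ ∃ n, c t ∈ degComp K d n)
    (hcgen : ∀ w ∈ smallComm K d, δB w = 0 →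
      ∃ (N : ℕ) (h : Fin N → PolyUV K (d + 1)) (sel : Fin N → Fin M),
        (∀ r, h r ∈ MvPolynomial.supported K (smallSet d) ∧ δ' (h r) = 0) ∧
        w = ∑ r, act K (d + 1) (h r) (c (sel r)))
    -- the generators `e_1,…,e_k, f_1,…,f_L` of the algebra `K[U_d,V_d]^δ`
    (k L : ℕ) (e : Fin k → PolyUV K (d + 1)) (f : Fin L → PolyUV K (d + 1))
    (he : ∀ t, e t ∈ MvPolynomial.supported K (smallUSet d) ∧ δ' (e t) = 0)
    (hf : ∀ t, f t ∈ omegaSmall K d ∧ δ' (f t) = 0)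
    (hef : ∀ q ∈ MvPolynomial.supported K (smallSet d), δ' q = 0 →
      q ∈ Algebra.adjoin K (Set.range e ∪ Set.range f)) :
    ∀ w ∈ commIdeal K (d + 1), δB w = 0 →
      ∃ (N : ℕ) (h : Fin N → PolyUV K (d + 1)) (sel : Fin N → Fin M ⊕ Fin L),
        (∀ r, δ' (h r) = 0) ∧
        w = ∑ r, act K (d + 1) (h r)
          ((Sum.elim c fun j => piMapF K d (f j)) (sel r)) := by
  intro w hw hδw
  let g : Fin M ⊕ Fin L → comI K (d + 1) :=
    Sum.elim (fun t => ⟨c t, smallComm_le (hc t).1⟩) (fun j => ppi K d (f j))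
  have hg : ∀ s, (g s : FreeMetab K (d + 1)) = (Sum.elim c fun j => piMapF K d (f j)) s := by
    rintro (s | s)
    · rfl
    · exact (piMapF_eq (f s)).symm
  have hmem : (⟨w, hw⟩ : comI K (d + 1)) ∈ Gen δ' g := by
    obtain ⟨Q, S, ws, hQ, hws, heq⟩ := main_decomp α δ' hu hulast hv hvlast δB hleib hδx hδlast
      (w := ⟨w, hw⟩) hδw
    rw [heq]
    refine add_mem (sum_mem fun t _ => ?_) ?_
    · refine Gen_rho δ' g (monL_const δ' hulast hvlast t) ?_
      obtain ⟨N, h, sel, hh, hsum⟩ := hcgen _ (hws t).1 (hws t).2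
      have h1 : ws t = ∑ r, rho K (d + 1) (h r) (g (Sum.inl (sel r))) := by
        apply Subtype.ext
        rw [hsum, AddSubmonoidClass.coe_finsetSum]
        refine Finset.sum_congr rfl fun r _ => ?_
        rw [← act_eq]
        rfl
      rw [h1]
      exact sum_mem fun r _ => Submodule.subset_span ⟨h r, _, (hh r).2, rfl⟩
    · refine ppi_gen α δ' hu hulast hv hvlast g e f he (fun t => (hf t).2) (fun j => ?_) hef hQ
      refine Submodule.subset_span ⟨1, Sum.inr j, Derivation.map_one_eq_zero _, ?_⟩
      rw [map_one]
      rfl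
  obtain ⟨N, h, sel, hh, hsum⟩ := Gen_exists δ' g hmem
  refine ⟨N, h, sel, hh, ?_⟩
  have h2 := congrArg Subtype.val hsum
  rw [AddSubmonoidClass.coe_finsetSum] at h2
  refine h2.trans (Finset.sum_congr rfl fun r _ => ?_)
  rw [← hg, act_eq]

end Main
end
end
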